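/- Let q be a power of 2 and n ≥ 1. The number of orbits of O^+_{2n}(𝐅_q) acting by conjugation on the set of nilpotent elements of 𝔬^+_{2n}(𝐅_q) equals (1/2)p₂(n) if n is odd, and equals (1/2)(p₂(n) + p(n/2)) if n is even. -/

import Mathlib

open Module Finset

/-- The radical `V^⊥ = {v | ⟨v,w⟩ = 0 for all w}` of the polar form of `Q`. -/
def QuadraticForm.polarRadical {F V : Type*} [Field F] [AddCommGroup V] [Module F V]
    (Q : QuadraticForm F V) : Submodule F V :=
  LinearMap.ker (QuadraticMap.polarBilin Q)

/-- A quadratic space `(V, Q)` (in characteristic 2) is non-degenerate if `V ≠ 0`,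
`dim V^⊥ ≤ 1` and `Q(v) ≠ 0` for every nonzero `v ∈ V^⊥`. -/
def QuadraticForm.IsNondegenerateFormSpace {F V : Type*} [Field F] [AddCommGroup V] [Module F V]
    (Q : QuadraticForm F V) : Prop :=
  Nontrivial V ∧ Module.finrank F Q.polarRadical ≤ 1 ∧
    ∀ v ∈ Q.polarRadical, v ≠ 0 → Q v ≠ 0

/-- Membership in the orthogonal Lie algebra
`𝔬(V) = {x ∈ End(V) | ⟨xv, v⟩ = 0 ∀ v, tr x = 0}`. -/
def QuadraticForm.mem_oLie {F V : Type*} [Field F] [AddCommGroup V] [Module F V]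
    (Q : QuadraticForm F V) (x : Module.End F V) : Prop :=
  (∀ v : V, QuadraticMap.polar Q (x v) v = 0) ∧ LinearMap.trace F V x = 0

/-- Two endomorphisms of `V` are conjugate under the orthogonal group
`O(V) = {g ∈ GL(V) | Q(gv) = Q(v) ∀ v}`. -/
def QuadraticForm.OConj {F V : Type*} [Field F] [AddCommGroup V] [Module F V]
    (Q : QuadraticForm F V) (x y : Module.End F V) : Prop :=
  ∃ g : V ≃ₗ[F] V, (∀ v : V, Q (g v) = Q v) ∧
    y = g.toLinearMap ∘ₗ x ∘ₗ g.symm.toLinearMap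

/-- The number of orbits of `O(V)` acting by conjugation on the set of nilpotent
elements of `𝔬(V)`. -/
noncomputable def QuadraticForm.numNilpotentOOrbits {F V : Type*} [Field F] [AddCommGroup V]
    [Module F V] (Q : QuadraticForm F V) : ℕ :=
  Nat.card (Quot fun x y : {x : Module.End F V // Q.mem_oLie x ∧ IsNilpotent x} =>
    Q.OConj x.1 y.1)

/-- `p(k)`, the number of partitions of `k`. -/
def numPartitions (k : ℕ) : ℕ := Fintype.card (Nat.Partition k)

/-- `p₂(n)`, the number of ordered pairs `(α, β)` of partitions with `|α| + |β| = n`. -/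
def numPartitionPairs (n : ℕ) : ℕ :=
  ∑ k ∈ Finset.range (n + 1), numPartitions k * numPartitions (n - k)

/-- `(V, Q)` contains a totally singular subspace of dimension `d`
(so the Witt index of `Q` is at least `d`). -/
def QuadraticForm.HasTotallySingularSubspace {F V : Type*} [Field F] [AddCommGroup V]
    [Module F V] (Q : QuadraticForm F V) (d : ℕ) : Prop :=
  ∃ W : Submodule F V, Module.finrank F W = d ∧ ∀ w ∈ W, Q w = 0


namespace NilOrb
set_option linter.unusedSectionVars false

/-! ### The Artin-Schreier character -/
section AS
variable (F : Type*) [Field F] [Fintype F] [CharP F 2]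

/-- The Artin-Schreier map `y ↦ y^2 + y`. -/
def asHom : F →+ F where
  toFun y := y ^ 2 + y
  map_zero' := by ring
  map_add' a b := by rw [CharTwo.add_sq]; ring

/-- The image of the Artin-Schreier map. -/
def asP : AddSubgroup F := (asHom F).range

theorem as_index : (asP F).index = 2 := by
  unfold asP
  rw [AddSubgroup.index_range]
  have : ((asHom F).ker : Set F) = {0, 1} := by
    ext y
    simp only [SetLike.mem_coe, AddMonoidHom.mem_ker, asHom, AddMonoidHom.coe_mk, ZeroHom.coe_mk,
      Set.mem_insert_iff, Set.mem_singleton_iff]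
    constructor
    · intro h
      have h' : y * (y + 1) = 0 := by linear_combination h
      rcases mul_eq_zero.1 h' with h | h
      · exact Or.inl h
      · right
        exact CharTwo.add_eq_zero.1 h
    · rintro (rfl | rfl)
      · ring
      · rw [one_pow]; exact CharTwo.add_self_eq_zero 1
  change Nat.card ((asHom F).ker : Set F) = 2
  rw [this, Nat.card_coe_set_eq, Set.ncard_pair zero_ne_one]

theorem exists_notMem_asP : ∃ t : F, t ∉ asP F := by
  by_contra h
  push Not at h
  have : asP F = ⊤ := by ext y; simp [h y]
  have h2 := as_index F
  rw [this] at h2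
  simp at h2

variable {F}

theorem sq_add_mem_asP (y : F) : y ^ 2 + y ∈ asP F := ⟨y, rfl⟩

theorem as_add_mem {a b : F} : a + b ∈ asP F ↔ (a ∈ asP F ↔ b ∈ asP F) :=
  AddSubgroup.add_mem_iff_of_index_two (as_index F)

theorem as_normal {t : F} (ht : t ∉ asP F) (y : F) :
    ∃ z : F, ∃ d : Bool, y + z ^ 2 + z = if d then t else 0 := by
  by_cases hy : y ∈ asP F
  · obtain ⟨z, hz⟩ := hy
    refine ⟨z, false, ?_⟩
    have hz' : z ^ 2 + z = y := hz
    rw [add_assoc, hz', CharTwo.add_self_eq_zero]; simp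
  · have : y + t ∈ asP F := by rw [as_add_mem]; tauto
    obtain ⟨z, hz⟩ := this
    have hz' : z ^ 2 + z = y + t := hz
    refine ⟨z, true, ?_⟩
    rw [add_assoc, hz', ← add_assoc, CharTwo.add_self_eq_zero]; simp

open Classical in
/-- The quadratic-type additive character with kernel `asP F`. -/
noncomputable def psi (y : F) : ℤ := if y ∈ asP F then 1 else -1

theorem psi_add (a b : F) : psi (a + b) = psi a * psi b := by
  unfold psi
  have := @as_add_mem F _ _ _ a b
  by_cases h1 : a ∈ asP F <;> by_cases h2 : b ∈ asP F <;> simp [h1, h2, this]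

theorem psi_zero : psi (0 : F) = 1 := by simp [psi, (asP F).zero_mem]

theorem psi_sq_add (a b : F) : psi (a ^ 2 + b) = psi (a + b) := by
  have h : psi (a ^ 2 + a) = 1 := by simp [psi, sq_add_mem_asP]
  have : a ^ 2 + b = (a ^ 2 + a) + (a + b) := by
    have := CharTwo.add_self_eq_zero a
    linear_combination -this
  rw [this, psi_add, h, one_mul]

theorem psi_eq_one_iff (a : F) : psi a = 1 ↔ a ∈ asP F := by
  unfold psi; split_ifs <;> simp_all

theorem psi_ne {t : F} (ht : t ∉ asP F) : psi t = -1 := by simp [psi, ht]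

theorem psi_eq_or (a : F) : psi a = 1 ∨ psi a = -1 := by
  unfold psi; split_ifs <;> simp

/-- If `psi` is trivial on a line, the slope vanishes. -/
theorem eq_zero_of_psi_line {c : F} (h : ∀ y : F, psi (y * c) = 1) : c = 0 := by
  by_contra hc
  obtain ⟨t, ht⟩ := exists_notMem_asP F
  have := h (t / c)
  rw [div_mul_cancel₀ _ hc, psi_ne ht] at this
  norm_num at this

theorem exists_sqrt (c : F) : ∃ a : F, a ^ 2 = c := by
  obtain ⟨a, ha⟩ := (isSquare_iff_exists_sq c).1 (FiniteField.isSquare_of_char_two (ringChar.eq F 2 ▸ rfl) c)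
  exact ⟨a, ha.symm⟩

end AS

/-! ### Basic identities -/
section Basic
variable {F : Type*} [Field F] [CharP F 2]
variable {V : Type*} [AddCommGroup V] [Module F V]
variable {Q : QuadraticForm F V} {x : Module.End F V}
open QuadraticMap

/-- `x` is "strongly self-adjoint". -/
def SA (Q : QuadraticForm F V) (x : Module.End F V) : Prop := ∀ v : V, polar Q (x v) v = 0

theorem polar_self0 (v : V) : polar Q v v = 0 := by
  rw [polar_self, two_nsmul, CharTwo.add_self_eq_zero]

theorem SA.symm (hx : SA Q x) (v w : V) : polar Q (x v) w = polar Q v (x w) := by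
  have h := hx (v + w)
  simp only [map_add, polar_add_left, polar_add_right, hx v, hx w, zero_add, add_zero] at h
  rw [polar_comm Q v (x w)]
  exact CharTwo.add_eq_zero.1 (by linear_combination h)

theorem SA.pow_symm (hx : SA Q x) (a : ℕ) (v w : V) :
    polar Q ((x ^ a) v) w = polar Q v ((x ^ a) w) := by
  induction a generalizing v w with
  | zero => simp
  | succ a ih =>
    rw [pow_succ, Module.End.mul_apply, ih, hx.symm, ← Module.End.mul_apply, ← pow_succ',
      ← pow_succ]

theorem SA.alt (hx : SA Q x) (a : ℕ) (v : V) : polar Q ((x ^ a) v) v = 0 := by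
  rcases Nat.even_or_odd' a with ⟨b, rfl | rfl⟩
  · rw [two_mul, pow_add, Module.End.mul_apply, hx.pow_symm]
    exact polar_self0 _
  · rw [pow_succ', two_mul, pow_add, Module.End.mul_apply, Module.End.mul_apply, hx.symm,
      hx.pow_symm, polar_comm, ← Module.End.mul_apply (x ^ b) x, ← pow_succ, pow_succ',
      Module.End.mul_apply]
    exact hx _

theorem pow_pow_apply (x : Module.End F V) (a b : ℕ) (v : V) :
    (x ^ a) ((x ^ b) v) = (x ^ (a + b)) v := by
  rw [pow_add, Module.End.mul_apply]

theorem pow_zero_of_le {a b : ℕ} {v : V} (h : (x ^ a) v = 0) (hab : a ≤ b) : (x ^ b) v = 0 := by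
  obtain ⟨c, rfl⟩ := Nat.exists_eq_add_of_le' hab
  rw [pow_add, Module.End.mul_apply, h, map_zero]

theorem SA.move (hx : SA Q x) (a b : ℕ) (v w : V) :
    polar Q ((x ^ a) v) ((x ^ b) w) = polar Q ((x ^ (a + b)) v) w := by
  rw [← hx.pow_symm, pow_pow_apply, add_comm]

theorem SA.alt2 (hx : SA Q x) (a b : ℕ) (v : V) : polar Q ((x ^ a) v) ((x ^ b) v) = 0 := by
  rw [hx.move, hx.alt]

/-- The basic formula for `Q` on `v + c x^j w`. -/
theorem SA.Q_add (hx : SA Q x) (a j : ℕ) (c : F) (v w : V) :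
    Q ((x ^ a) (v + c • (x ^ j) w)) =
      Q ((x ^ a) v) + c ^ 2 * Q ((x ^ (a + j)) w) + c * polar Q ((x ^ (2 * a + j)) v) w := by
  have h1 := QuadraticMap.map_add Q ((x ^ a) v) (c • (x ^ (a + j)) w)
  rw [polar_smul_right, hx.move, QuadraticMap.map_smul] at h1
  rw [map_add, map_smul, pow_pow_apply, h1]
  simp only [smul_eq_mul]
  rw [show a + (a + j) = 2 * a + j by ring]; ring

theorem SA.comm' (hx : SA Q x) (a : ℕ) (v w : V) :
    polar Q ((x ^ a) v) w = polar Q ((x ^ a) w) v := by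
  rw [hx.pow_symm, polar_comm]

end Basic
end NilOrb

namespace NilOrb
set_option linter.unusedSectionVars false
section Block
variable {F : Type*} [Field F] [Fintype F] [CharP F 2]
variable {V : Type*} [AddCommGroup V] [Module F V]
variable {Q : QuadraticForm F V} {x : Module.End F V}
open QuadraticMap

/-- `U` is stable under `x`. -/
def Stab (x : Module.End F V) (U : Submodule F V) : Prop := ∀ v ∈ U, x v ∈ U

theorem Stab.pow {U : Submodule F V} (h : Stab x U) (a : ℕ) {v : V} (hv : v ∈ U) :
    (x ^ a) v ∈ U := by
  induction a with
  | zero => simpa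
  | succ a ih => rw [pow_succ', Module.End.mul_apply]; exact h _ ih

/-- Normalizing the values of `Q` on the cyclic module of `e`. -/
theorem e_norm (hx : SA Q x) {l : ℕ} (hl : 1 ≤ l) {e : V}
    (h0 : ∀ a, l ≤ a → Q ((x ^ a) e) = 0) (h1 : Q ((x ^ (l - 1)) e) ≠ 0) :
    ∃ e' : V, (∀ U : Submodule F V, Stab x U → e ∈ U → e' ∈ U) ∧
      (∀ a, Q ((x ^ a) e') = if a + 1 = l then 1 else 0) ∧
      (∀ m, (x ^ m) e = 0 → (x ^ m) e' = 0) ∧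
      (∀ (f : V) (m : ℕ), 1 ≤ m → (∀ a, m ≤ a → polar Q ((x ^ a) e) f = 0) →
        polar Q ((x ^ (m - 1)) e) f ≠ 0 →
        (∀ a, m ≤ a → polar Q ((x ^ a) e') f = 0) ∧ polar Q ((x ^ (m - 1)) e') f ≠ 0) := by
  have key : ∀ k : ℕ, ∃ e' : V, (∀ U : Submodule F V, Stab x U → e ∈ U → e' ∈ U) ∧
      (∀ a, l ≤ a → Q ((x ^ a) e') = 0) ∧ Q ((x ^ (l - 1)) e') = 1 ∧
      (∀ a, a + 1 < l → l ≤ a + k + 1 → Q ((x ^ a) e') = 0) ∧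
      (∀ m, (x ^ m) e = 0 → (x ^ m) e' = 0) ∧
      (∀ (f : V) (m : ℕ), 1 ≤ m → (∀ a, m ≤ a → polar Q ((x ^ a) e) f = 0) →
        polar Q ((x ^ (m - 1)) e) f ≠ 0 →
        (∀ a, m ≤ a → polar Q ((x ^ a) e') f = 0) ∧ polar Q ((x ^ (m - 1)) e') f ≠ 0) := by
    intro k
    induction k with
    | zero =>
      obtain ⟨c, hc⟩ := exists_sqrt (Q ((x ^ (l - 1)) e))⁻¹
      have hc0 : c ≠ 0 := by
        rintro rfl
        apply h1
        have : (Q ((x ^ (l - 1)) e))⁻¹ = 0 := by rw [← hc]; ring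
        exact inv_eq_zero.1 this
      refine ⟨c • e, fun U hU he => U.smul_mem _ he, ?_, ?_, ?_, ?_, ?_⟩
      · intro a ha
        rw [map_smul, QuadraticMap.map_smul, h0 a ha, smul_zero]
      · rw [map_smul, QuadraticMap.map_smul, ← pow_two, hc, smul_eq_mul, inv_mul_cancel₀ h1]
      · intro a h h'; omega
      · intro m hm; rw [map_smul, hm, smul_zero]
      · intro f m hm h2 h3
        refine ⟨fun a ha => ?_, ?_⟩
        · rw [map_smul, polar_smul_left, h2 a ha, smul_zero]
        · rw [map_smul, polar_smul_left]
          exact mul_ne_zero hc0 h3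
    | succ k ih =>
      obtain ⟨e', hU, hq0, hq1, hq2, hz, hf⟩ := ih
      by_cases hk : k + 2 ≤ l
      · obtain ⟨c, hc⟩ := exists_sqrt (Q ((x ^ (l - 2 - k)) e'))
        have hQ : ∀ a, Q ((x ^ a) (e' + c • (x ^ (k + 1)) e')) =
            Q ((x ^ a) e') + c ^ 2 * Q ((x ^ (a + (k + 1))) e') := by
          intro a
          rw [hx.Q_add, hx.alt, mul_zero, add_zero]
        refine ⟨e' + c • (x ^ (k + 1)) e', ?_, ?_, ?_, ?_, ?_, ?_⟩
        · intro U hs he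
          exact U.add_mem (hU U hs he) (U.smul_mem _ (hs.pow _ (hU U hs he)))
        · intro a ha
          rw [hQ, hq0 a ha, hq0 _ (by omega)]; ring
        · rw [hQ, hq1, hq0 _ (by omega)]; ring
        · intro a ha ha'
          rw [hQ]
          by_cases h : a = l - 2 - k
          · subst h
            rw [show l - 2 - k + (k + 1) = l - 1 by omega, hq1, hc, mul_one]
            exact CharTwo.add_self_eq_zero _
          · rw [hq2 a ha (by omega), hq0 _ (by omega)]; ring
        · intro m hm
          rw [map_add, map_smul, pow_pow_apply, hz m hm,
            pow_zero_of_le (hz m hm) (Nat.le_add_right _ _)]; simp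
        · intro f m hm h2 h3
          obtain ⟨g1, g2⟩ := hf f m hm h2 h3
          refine ⟨fun a ha => ?_, ?_⟩
          · rw [map_add, map_smul, pow_pow_apply, polar_add_left, polar_smul_left, g1 a ha,
              g1 _ (by omega)]; simp
          · rw [map_add, map_smul, pow_pow_apply, polar_add_left, polar_smul_left,
              g1 (m - 1 + (k + 1)) (by omega)]; simpa using g2
      · refine ⟨e', hU, hq0, hq1, ?_, hz, hf⟩
        intro a h1 h2
        exact hq2 a h1 (by omega)
  obtain ⟨e', hU, hq0, hq1, hq2, hz, hf⟩ := key l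
  refine ⟨e', hU, ?_, hz, hf⟩
  intro a
  split_ifs with h
  · rw [← hq1, ← h]; simp
  · by_cases h' : l ≤ a
    · exact hq0 a h'
    · exact hq2 a (by omega) (by omega)

/-- Finding a dual vector. -/
theorem f_norm (hx : SA Q x) {m : ℕ} (hm : 1 ≤ m) {e f : V}
    (h0 : ∀ a, m ≤ a → polar Q ((x ^ a) e) f = 0) (h1 : polar Q ((x ^ (m - 1)) e) f ≠ 0) :
    ∃ f' : V, (∀ U : Submodule F V, Stab x U → f ∈ U → f' ∈ U) ∧
      (∀ a, polar Q ((x ^ a) e) f' = if a + 1 = m then 1 else 0) ∧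
      (∀ m, (x ^ m) f = 0 → (x ^ m) f' = 0) ∧
      (∀ l, (∀ a, l ≤ a → Q ((x ^ a) f) = 0) → (∀ a, l ≤ a → Q ((x ^ a) f') = 0)) := by
  have key : ∀ k : ℕ, ∃ f' : V, (∀ U : Submodule F V, Stab x U → f ∈ U → f' ∈ U) ∧
      (∀ a, m ≤ a → polar Q ((x ^ a) e) f' = 0) ∧ polar Q ((x ^ (m - 1)) e) f' = 1 ∧
      (∀ a, a + 1 < m → m ≤ a + k + 1 → polar Q ((x ^ a) e) f' = 0) ∧
      (∀ m, (x ^ m) f = 0 → (x ^ m) f' = 0) ∧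
      (∀ l, (∀ a, l ≤ a → Q ((x ^ a) f) = 0) → (∀ a, l ≤ a → Q ((x ^ a) f') = 0)) := by
    intro k
    induction k with
    | zero =>
      refine ⟨(polar Q ((x ^ (m - 1)) e) f)⁻¹ • f, fun U hU he => U.smul_mem _ he, ?_, ?_, ?_, ?_,
        ?_⟩
      · intro a ha
        rw [polar_smul_right, h0 a ha, smul_zero]
      · rw [polar_smul_right, smul_eq_mul, inv_mul_cancel₀ h1]
      · intro a h h'; omega
      · intro m hm; rw [map_smul, hm, smul_zero]
      · intro l hl a ha
        rw [map_smul, QuadraticMap.map_smul, hl a ha, smul_zero]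
    | succ k ih =>
      obtain ⟨f', hU, hq0, hq1, hq2, hz, hf⟩ := ih
      by_cases hk : k + 2 ≤ m
      · set c := polar Q ((x ^ (m - 2 - k)) e) f' with hc
        have hQ : ∀ a, polar Q ((x ^ a) e) (f' + c • (x ^ (k + 1)) f') =
            polar Q ((x ^ a) e) f' + c * polar Q ((x ^ (a + (k + 1))) e) f' := by
          intro a
          rw [polar_add_right, polar_smul_right, hx.move, smul_eq_mul]
        refine ⟨f' + c • (x ^ (k + 1)) f', ?_, ?_, ?_, ?_, ?_, ?_⟩
        · intro U hs he
          exact U.add_mem (hU U hs he) (U.smul_mem _ (hs.pow _ (hU U hs he)))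
        · intro a ha
          rw [hQ, hq0 a ha, hq0 _ (by omega)]; ring
        · rw [hQ, hq1, hq0 _ (by omega)]; ring
        · intro a ha ha'
          rw [hQ]
          by_cases h : a = m - 2 - k
          · subst h
            rw [show m - 2 - k + (k + 1) = m - 1 by omega, hq1, ← hc, mul_one]
            exact CharTwo.add_self_eq_zero _
          · rw [hq2 a ha (by omega), hq0 _ (by omega)]; ring
        · intro m hm
          rw [map_add, map_smul, pow_pow_apply, hz m hm,
            pow_zero_of_le (hz m hm) (Nat.le_add_right _ _)]; simp
        · intro l hl a ha
          rw [hx.Q_add, hx.alt, mul_zero, add_zero, hf l hl a ha, hf l hl _ (by omega)]; ring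
      · refine ⟨f', hU, hq0, hq1, ?_, hz, hf⟩
        intro a h1 h2
        exact hq2 a h1 (by omega)
  obtain ⟨f', hU, hq0, hq1, hq2, hz, hf⟩ := key m
  refine ⟨f', hU, ?_, hz, hf⟩
  intro a
  split_ifs with h
  · rw [← hq1, ← h]; simp
  · by_cases h' : m ≤ a
    · exact hq0 a h'
    · exact hq2 a (by omega) (by omega)

end Block
end NilOrb

namespace NilOrb
set_option linter.unusedSectionVars false
section Block
variable {F : Type*} [Field F] [Fintype F] [CharP F 2]
variable {V : Type*} [AddCommGroup V] [Module F V]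
variable {Q : QuadraticForm F V} {x : Module.End F V}
open QuadraticMap

theorem f_kill (hx : SA Q x) {t : F} (ht : t ∉ asP F) {l r m : ℕ} (hlr : l + r = m) (hrl : r ≤ l)
    {e f : V} (he0 : ∀ a, l ≤ a → Q ((x ^ a) e) = 0)
    (he1 : r < l → ∀ a, Q ((x ^ a) e) = if a + 1 = l then 1 else 0)
    (hef : ∀ a, polar Q ((x ^ a) e) f = if a + 1 = m then 1 else 0)
    (hf : ∀ a, l ≤ a → Q ((x ^ a) f) = 0) (hze : (x ^ m) e = 0) (hzf : (x ^ m) f = 0) :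
    ∃ (f' : V) (d : Bool), (∀ U : Submodule F V, Stab x U → e ∈ U → f ∈ U → f' ∈ U) ∧
      (∀ a, polar Q ((x ^ a) e) f' = if a + 1 = m then 1 else 0) ∧ (x ^ m) f' = 0 ∧
      (r = l → d = false) ∧
      (∀ a, Q ((x ^ a) f') = if a = r ∧ r < l ∧ d = true then t else 0) := by
  have key : ∀ k : ℕ, ∃ (f' : V) (d : Bool),
      (∀ U : Submodule F V, Stab x U → e ∈ U → f ∈ U → f' ∈ U) ∧
      (∀ a, polar Q ((x ^ a) e) f' = if a + 1 = m then 1 else 0) ∧ (x ^ m) f' = 0 ∧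
      (r = l → d = false) ∧
      (∀ a, l ≤ a + k → Q ((x ^ a) f') = if a = r ∧ r < l ∧ d = true then t else 0) := by
    intro k
    induction k with
    | zero =>
      refine ⟨f, false, fun U _ _ h => h, hef, hzf, fun _ => rfl, ?_⟩
      intro a ha
      simp [hf a (by omega)]
    | succ k ih =>
      obtain ⟨f', d, hU, hb, hz, hd, hQ⟩ := ih
      by_cases hk : l ≤ k
      · refine ⟨f', d, hU, hb, hz, hd, fun a ha => hQ a (by omega)⟩
      push Not at hk
      have step : ∀ (j : ℕ) (c : F) (a : ℕ), Q ((x ^ a) (f' + c • (x ^ j) e)) =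
          Q ((x ^ a) f') + c ^ 2 * Q ((x ^ (a + j)) e) + c * (if 2 * a + j + 1 = m then 1 else 0) := by
        intro j c a
        rw [hx.Q_add, hx.comm' _ f' e, hb]
      have stepU : ∀ (j : ℕ) (c : F), (∀ U : Submodule F V, Stab x U → e ∈ U → f ∈ U →
          f' + c • (x ^ j) e ∈ U) := by
        intro j c U hs h1 h2
        exact U.add_mem (hU U hs h1 h2) (U.smul_mem _ (hs.pow _ h1))
      have stepb : ∀ (j : ℕ) (c : F) (a : ℕ), polar Q ((x ^ a) e) (f' + c • (x ^ j) e) =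
          if a + 1 = m then 1 else 0 := by
        intro j c a
        rw [polar_add_right, polar_smul_right, hx.alt2, hb, smul_zero, add_zero]
      have stepz : ∀ (j : ℕ) (c : F), (x ^ m) (f' + c • (x ^ j) e) = 0 := by
        intro j c
        rw [map_add, map_smul, pow_pow_apply, hz, pow_zero_of_le hze (by omega)]; simp
      rcases lt_trichotomy (l - 1 - k) r with h | h | h
      · refine ⟨f' + Q ((x ^ (l - 1 - k)) f') • (x ^ (m - 1 - 2 * (l - 1 - k))) e, d, stepU _ _,
          stepb _ _, stepz _ _, hd, ?_⟩
        intro a ha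
        rw [step, he0 _ (by omega)]
        by_cases h' : a = l - 1 - k
        · subst h'
          rw [if_pos (by omega), if_neg (by omega), mul_zero, add_zero, mul_one]
          exact CharTwo.add_self_eq_zero _
        · rw [if_neg (by omega), hQ a (by omega)]; ring
      · have hlt : r < l := by omega
        obtain ⟨z, d', hz'⟩ := as_normal ht (Q ((x ^ r) f'))
        refine ⟨f' + z • (x ^ k) e, d', stepU _ _, stepb _ _, stepz _ _, by omega, ?_⟩
        intro a ha
        rw [step, he1 hlt]
        by_cases h' : a = r
        · subst h'
          rw [if_pos (by omega), if_pos (by omega), mul_one, mul_one, hz']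
          simp [hlt]
        · rw [if_neg (by omega), if_neg (by omega), if_neg (by tauto), hQ a (by omega),
            if_neg (by tauto)]; ring
      · have hlt : r < l := by omega
        obtain ⟨c, hc⟩ := exists_sqrt (Q ((x ^ (l - 1 - k)) f'))
        refine ⟨f' + c • (x ^ k) e, d, stepU _ _, stepb _ _, stepz _ _, hd, ?_⟩
        intro a ha
        rw [step, he1 hlt]
        by_cases h' : a = l - 1 - k
        · subst h'
          rw [if_pos (by omega), if_neg (by omega), if_neg (by omega), mul_one, hc, mul_zero,
            add_zero]
          exact CharTwo.add_self_eq_zero _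
        · rw [if_neg (by omega), if_neg (by omega), hQ a (by omega)]; ring
  obtain ⟨f', d, hU, hb, hz, hd, hQ⟩ := key l
  exact ⟨f', d, hU, hb, hz, hd, fun a => hQ a (by omega)⟩

/-- Normal form of a block. -/
structure NB (Q : QuadraticForm F V) (x : Module.End F V) (t : F) (l r : ℕ) (d : Bool) (e f : V) :
    Prop where
  le : r ≤ l
  hd : r = l → d = false
  he : ∀ a, Q ((x ^ a) e) = if a + 1 = l ∧ r < l then 1 else 0
  hf : ∀ a, Q ((x ^ a) f) = if a = r ∧ r < l ∧ d = true then t else 0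

/-- `(e, f)` is a hyperbolic block of size `m`. -/
structure HB (Q : QuadraticForm F V) (x : Module.End F V) (m : ℕ) (e f : V) : Prop where
  ef : ∀ a, polar Q ((x ^ a) e) f = if a + 1 = m then 1 else 0
  ze : (x ^ m) e = 0
  zf : (x ^ m) f = 0

theorem HB.swap (hx : SA Q x) {m : ℕ} {e f : V} (h : HB Q x m e f) : HB Q x m f e :=
  ⟨fun a => by rw [hx.comm', h.ef], h.zf, h.ze⟩

theorem exists_order {g : ℕ → F} {m : ℕ} (h : ∀ a, m ≤ a → g a = 0) :
    ∃ l, (∀ a, l ≤ a → g a = 0) ∧ (l = 0 ∨ g (l - 1) ≠ 0) := by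
  classical
  have hex : ∃ l, ∀ a, l ≤ a → g a = 0 := ⟨m, h⟩
  refine ⟨Nat.find hex, Nat.find_spec hex, ?_⟩
  by_contra hc
  push Not at hc
  have := Nat.find_min hex (m := Nat.find hex - 1) (by omega)
  apply this
  intro a ha
  by_cases h' : a = Nat.find hex - 1
  · rw [h']; exact hc.2
  · exact Nat.find_spec hex a (by omega)

/-- Case 1 of the block normalization. -/
theorem block_case1 (hx : SA Q x) {t : F} (ht : t ∉ asP F) {m l : ℕ} {e f : V} (h : HB Q x m e f)
    (hl : m < 2 * l) (hlm : l ≤ m)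
    (he0 : ∀ a, l ≤ a → Q ((x ^ a) e) = 0) (he1 : Q ((x ^ (l - 1)) e) ≠ 0)
    (hf0 : ∀ a, l ≤ a → Q ((x ^ a) f) = 0) :
    ∃ (d : Bool) (e' f' : V), NB Q x t l (m - l) d e' f' ∧ HB Q x m e' f' ∧
      (∀ U : Submodule F V, Stab x U → e ∈ U → f ∈ U → e' ∈ U ∧ f' ∈ U) := by
  obtain ⟨e1, hU1, hQ1, hz1, hb1⟩ := e_norm hx (by omega) he0 he1
  obtain ⟨b0, b1⟩ := hb1 f m (by omega)
    (fun a ha => by rw [h.ef, if_neg (by omega)])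
    (by rw [h.ef, if_pos (by omega)]; exact one_ne_zero)
  obtain ⟨f1, hU2, hef, hz2, hQ2⟩ := f_norm hx (by omega) b0 b1
  obtain ⟨f2, d, hU3, hef3, hz3, hd3, hQ3⟩ := f_kill hx ht (l := l) (r := m - l) (m := m) (by omega)
    (by omega) (fun a ha => by rw [hQ1, if_neg (by omega)]) (fun _ => hQ1) hef (hQ2 l hf0)
    (hz1 m h.ze) (hz2 m h.zf)
  refine ⟨d, e1, f2, ⟨by omega, hd3, ?_, hQ3⟩, ⟨hef3, hz1 m h.ze, hz3⟩, ?_⟩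
  · intro a; rw [hQ1]
    have : m - l < l := by omega
    simp [this]
  · intro U hs h1 h2
    exact ⟨hU1 U hs h1, hU3 U hs (hU1 U hs h1) (hU2 U hs h2)⟩

theorem block_norm (hx : SA Q x) {t : F} (ht : t ∉ asP F) {m : ℕ} {e f : V} (h : HB Q x m e f) :
    ∃ (l r : ℕ) (d : Bool) (e' f' : V), l + r = m ∧ NB Q x t l r d e' f' ∧ HB Q x m e' f' ∧
      (∀ a, Q ((x ^ a) e) ≠ 0 → a + 1 ≤ l) ∧
      (∀ U : Submodule F V, Stab x U → e ∈ U → f ∈ U → e' ∈ U ∧ f' ∈ U) := by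
  have hme : ∀ a, m ≤ a → Q ((x ^ a) e) = 0 := fun a ha => by
    rw [pow_zero_of_le h.ze ha, QuadraticMap.map_zero]
  have hmf : ∀ a, m ≤ a → Q ((x ^ a) f) = 0 := fun a ha => by
    rw [pow_zero_of_le h.zf ha, QuadraticMap.map_zero]
  obtain ⟨le, he0, he1⟩ := exists_order hme
  obtain ⟨lf, hf0, hf1⟩ := exists_order hmf
  have hlem : le ≤ m := by
    by_contra hc
    rcases he1 with h1 | h1
    · omega
    · exact h1 (hme _ (by omega))
  have hlfm : lf ≤ m := by
    by_contra hc
    rcases hf1 with h1 | h1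
    · omega
    · exact h1 (hmf _ (by omega))
  have horder : ∀ a, Q ((x ^ a) e) ≠ 0 → a + 1 ≤ le := by
    intro a ha
    by_contra hc
    exact ha (he0 a (by omega))
  by_cases c1 : lf ≤ le ∧ m < 2 * le
  · obtain ⟨d, e', f', h1, h2, h3⟩ := block_case1 hx ht h c1.2 hlem he0
      (he1.resolve_left (by omega)) (fun a ha => hf0 a (by omega))
    exact ⟨le, m - le, d, e', f', by omega, h1, h2, horder, h3⟩
  by_cases c2 : le ≤ lf ∧ m < 2 * lf
  · obtain ⟨d, e', f', h1, h2, h3⟩ := block_case1 hx ht (h.swap hx) c2.2 hlfm hf0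
      (hf1.resolve_left (by omega)) (fun a ha => he0 a (by omega))
    exact ⟨lf, m - lf, d, e', f', by omega, h1, h2, fun a ha => (horder a ha).trans c2.1,
      fun U hs h1 h2 => h3 U hs h2 h1⟩
  have hle2 : 2 * le ≤ m := by omega
  have hlf2 : 2 * lf ≤ m := by omega
  rcases Nat.even_or_odd' m with ⟨k, hk | hk⟩
  · obtain ⟨e', d', hU, hb, hz, hd, hQ⟩ := f_kill hx ht (l := k) (r := k) (m := m) (by omega) le_rfl
      (e := f) (f := e) (fun a ha => hf0 a (by omega)) (fun hh => absurd hh (lt_irrefl _))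
      (h.swap hx).ef (fun a ha => he0 a (by omega)) h.zf h.ze
    have hQ' : ∀ a, Q ((x ^ a) e') = 0 := fun a => by rw [hQ]; simp
    obtain ⟨f', d'', hU2, hb2, hz2, hd2, hQ2⟩ := f_kill hx ht (l := k) (r := k) (m := m) (by omega)
      le_rfl (e := e') (f := f) (fun a ha => hQ' a) (fun hh => absurd hh (lt_irrefl _))
      (fun a => by rw [hx.comm', hb]) (fun a ha => hf0 a (by omega)) hz h.zf
    refine ⟨k, k, d'', e', f', by omega, ⟨le_rfl, hd2, fun a => by rw [hQ']; simp, hQ2⟩,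
      ⟨hb2, hz, hz2⟩, fun a ha => (horder a ha).trans (by omega), ?_⟩
    intro U hs h1 h2
    have := hU U hs h2 h1
    exact ⟨this, hU2 U hs this h2⟩
  · have hB : HB Q x m (e + f) f := by
      refine ⟨fun a => ?_, ?_, h.zf⟩
      · rw [map_add, polar_add_left, hx.alt, h.ef, add_zero]
      · rw [map_add, h.ze, h.zf, add_zero]
    have hQ : ∀ a, Q ((x ^ a) (e + f)) = Q ((x ^ a) e) + Q ((x ^ a) f) +
        if 2 * a + 1 = m then 1 else 0 := by
      intro a
      have := hx.Q_add a 0 1 e f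
      simp only [pow_zero, Module.End.one_apply, one_smul, add_zero] at this
      rw [this, h.ef]; ring
    obtain ⟨d, e', f', h1, h2, h3⟩ := block_case1 hx ht (l := k + 1) hB (by omega) (by omega)
      (fun a ha => by rw [hQ, he0 a (by omega), hf0 a (by omega), if_neg (by omega)]; ring)
      (by
        rw [hQ, he0 _ (by omega), hf0 _ (by omega), if_pos (by omega)]
        simp)
      (fun a ha => hf0 a (by omega))
    exact ⟨k + 1, m - (k + 1), d, e', f', by omega, h1, h2,
      fun a ha => (horder a ha).trans (by omega),
      fun U hs h1 h2 => h3 U hs (U.add_mem h1 h2) h2⟩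

end Block
end NilOrb

namespace NilOrb
set_option linter.unusedSectionVars false
section Frame
variable {F : Type*} [Field F] [Fintype F] [CharP F 2]
variable {V : Type*} [AddCommGroup V] [Module F V]
variable {Q : QuadraticForm F V} {x : Module.End F V} {n : ℕ}
open QuadraticMap

/-- A partial frame. -/
structure PF (Q : QuadraticForm F V) (x : Module.End F V) (m : Fin n → ℕ) (e f : Fin n → V) :
    Prop where
  hb : ∀ i, HB Q x (m i) (e i) (f i)
  ee : ∀ i j, i ≠ j → ∀ a, polar Q ((x ^ a) (e i)) (e j) = 0
  ff : ∀ i j, i ≠ j → ∀ a, polar Q ((x ^ a) (f i)) (f j) = 0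
  ef : ∀ i j, i ≠ j → ∀ a, polar Q ((x ^ a) (e i)) (f j) = 0

variable {m : Fin n → ℕ} {e f : Fin n → V}

theorem PF.ee' (hx : SA Q x) (h : PF Q x m e f) (i j : Fin n) (a : ℕ) :
    polar Q ((x ^ a) (e i)) (e j) = 0 := by
  by_cases hij : i = j
  · subst hij; exact hx.alt _ _
  · exact h.ee i j hij a

theorem PF.ff' (hx : SA Q x) (h : PF Q x m e f) (i j : Fin n) (a : ℕ) :
    polar Q ((x ^ a) (f i)) (f j) = 0 := by
  by_cases hij : i = j
  · subst hij; exact hx.alt _ _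
  · exact h.ff i j hij a

theorem PF.ef' (h : PF Q x m e f) (i j : Fin n) (a : ℕ) :
    polar Q ((x ^ a) (e i)) (f j) = if i = j ∧ a + 1 = m i then 1 else 0 := by
  by_cases hij : i = j
  · subst hij; rw [(h.hb i).ef]; simp
  · rw [h.ef i j hij a, if_neg (by tauto)]

theorem PF.fe' (hx : SA Q x) (h : PF Q x m e f) (i j : Fin n) (a : ℕ) :
    polar Q ((x ^ a) (f i)) (e j) = if i = j ∧ a + 1 = m i then 1 else 0 := by
  rw [hx.comm', h.ef']
  by_cases hij : i = j
  · subst hij; rfl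
  · rw [if_neg (by tauto), if_neg (by tauto)]

open Classical in
theorem PF.swap (hx : SA Q x) (h : PF Q x m e f) (S : Fin n → Prop) :
    PF Q x m (fun i => if S i then f i else e i) (fun i => if S i then e i else f i) := by
  refine ⟨fun i => ?_, fun i j hij a => ?_, fun i j hij a => ?_, fun i j hij a => ?_⟩
  · by_cases hS : S i
    · simp only [hS, if_true]; exact (h.hb i).swap hx
    · simp only [hS, if_false]; exact h.hb i
  all_goals
    by_cases h1 : S i <;> by_cases h2 : S j <;>
      simp only [h1, h2, if_true, if_false]
    all_goals first
      | exact h.ee i j hij a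
      | exact h.ff i j hij a
      | exact h.ef i j hij a
      | (rw [hx.comm']; exact h.ef j i hij.symm a)

theorem PF.perm (h : PF Q x m e f) (s : Equiv.Perm (Fin n)) :
    PF Q x (m ∘ s) (e ∘ s) (f ∘ s) :=
  ⟨fun i => h.hb (s i), fun i j hij => h.ee _ _ (s.injective.ne hij),
    fun i j hij => h.ff _ _ (s.injective.ne hij), fun i j hij => h.ef _ _ (s.injective.ne hij)⟩

/-- The basic change of frame. -/
theorem PF.transv (hx : SA Q x) (h : PF Q x m e f) {i j : Fin n} (hij : i ≠ j) (hm : m j ≤ m i)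
    (c : F) (u : ℕ) :
    PF Q x m (Function.update e i (e i + c • (x ^ u) (e j)))
      (Function.update f j (f j + c • (x ^ (u + (m i - m j))) (f i))) := by
  have he : ∀ p, Function.update e i (e i + c • (x ^ u) (e j)) p =
      e p + (if p = i then c else 0) • (x ^ u) (e j) := by
    intro p
    by_cases hp : p = i
    · subst hp; simp
    · simp [hp]
  have hf : ∀ p, Function.update f j (f j + c • (x ^ (u + (m i - m j))) (f i)) p =
      f p + (if p = j then c else 0) • (x ^ (u + (m i - m j))) (f i) := by
    intro p
    by_cases hp : p = j
    · subst hp; simp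
    · simp [hp]
  have hef : ∀ p q a, polar Q ((x ^ a) (Function.update e i (e i + c • (x ^ u) (e j)) p))
      (Function.update f j (f j + c • (x ^ (u + (m i - m j))) (f i)) q) =
      if p = q ∧ a + 1 = m p then 1 else 0 := by
    intro p q a
    rw [he, hf]
    simp only [map_add, map_smul, polar_add_left, polar_add_right, polar_smul_left,
      polar_smul_right, hx.move, pow_pow_apply, h.ef', smul_eq_mul]
    simp only [hij.symm, false_and, if_false, mul_zero, add_zero]
    by_cases hp : p = i
    · by_cases hq : q = j
      · subst hp hq
        have e1 : (a + (u + (m p - m q)) + 1 = m p) ↔ (a + u + 1 = m q) := by omega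
        simp only [true_and, e1, if_true, hij, false_and, if_false, zero_add]
        rw [← mul_add, CharTwo.add_self_eq_zero]; try simp
      · subst hp
        simp [hq, Ne.symm hq]
    · simp [hp]
  refine ⟨fun p => ⟨fun a => ?_, ?_, ?_⟩, fun p q hpq a => ?_, fun p q hpq a => ?_,
    fun p q hpq a => ?_⟩
  · rw [hef]; simp
  · rw [he, map_add, (h.hb p).ze, map_smul, pow_pow_apply, zero_add]
    by_cases hp : p = i
    · subst hp
      rw [pow_zero_of_le (h.hb j).ze (by omega), smul_zero]
    · simp [hp]
  · rw [hf, map_add, (h.hb p).zf, map_smul, pow_pow_apply, zero_add]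
    by_cases hp : p = j
    · subst hp
      rw [pow_zero_of_le (h.hb i).zf (by omega), smul_zero]
    · simp [hp]
  · rw [he, he]
    simp only [map_add, map_smul, polar_add_left, polar_add_right, polar_smul_left,
      polar_smul_right, hx.move, pow_pow_apply, h.ee' hx, smul_zero, add_zero]
  · rw [hf, hf]
    simp only [map_add, map_smul, polar_add_left, polar_add_right, polar_smul_left,
      polar_smul_right, hx.move, pow_pow_apply, h.ff' hx, smul_zero, add_zero]
  · rw [hef, if_neg (by tauto)]

/-- The annihilator of a vector, stable version. -/
def perp (Q : QuadraticForm F V) (x : Module.End F V) (w : V) : Submodule F V where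
  carrier := {v | ∀ a, polar Q ((x ^ a) v) w = 0}
  add_mem' := by
    intro a b ha hb k
    rw [map_add, polar_add_left, ha k, hb k, add_zero]
  zero_mem' := by intro k; simp
  smul_mem' := by
    intro c v hv k
    rw [map_smul, polar_smul_left, hv k, smul_zero]

theorem mem_perp {v w : V} : v ∈ perp Q x w ↔ ∀ a, polar Q ((x ^ a) v) w = 0 := Iff.rfl

theorem perp_stab (w : V) : Stab x (perp Q x w) := by
  intro v hv a
  have := hv (a + 1)
  rwa [pow_succ, Module.End.mul_apply] at this

theorem perp_comm (hx : SA Q x) {v w : V} : v ∈ perp Q x w ↔ w ∈ perp Q x v := by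
  simp only [mem_perp]
  constructor <;> intro h a <;> rw [hx.comm'] <;> exact h a

/-- A good frame of type `(l, r, d)`. -/
structure GF (Q : QuadraticForm F V) (x : Module.End F V) (t : F) (l r : Fin n → ℕ)
    (d : Fin n → Bool) (e f : Fin n → V) : Prop where
  pf : PF Q x (fun i => l i + r i) e f
  nb : ∀ i, NB Q x t (l i) (r i) (d i) (e i) (f i)

/-- Normalization of some of the blocks. -/
theorem PF.normalize (hx : SA Q x) {t : F} (ht : t ∉ asP F) (h : PF Q x m e f) (S : Fin n → Prop)
    (l r : Fin n → ℕ) (d : Fin n → Bool) (hlr : ∀ i, l i + r i = m i)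
    (hS : ∀ i, ¬ S i → NB Q x t (l i) (r i) (d i) (e i) (f i)) :
    ∃ (l' r' : Fin n → ℕ) (d' : Fin n → Bool) (e' f' : Fin n → V),
      GF Q x t l' r' d' e' f' ∧ (∀ i, l' i + r' i = m i) ∧
      (∀ i, ¬ S i → l' i = l i ∧ r' i = r i ∧ d' i = d i) ∧
      (∀ i, S i → ∀ a, Q ((x ^ a) (e i)) ≠ 0 → a + 1 ≤ l' i) := by
  have key : ∀ i, ∃ (l' r' : ℕ) (d' : Bool) (e' f' : V), l' + r' = m i ∧
      NB Q x t l' r' d' e' f' ∧ HB Q x (m i) e' f' ∧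
      (∀ U : Submodule F V, Stab x U → e i ∈ U → f i ∈ U → e' ∈ U ∧ f' ∈ U) ∧
      (¬ S i → l' = l i ∧ r' = r i ∧ d' = d i) ∧
      (S i → ∀ a, Q ((x ^ a) (e i)) ≠ 0 → a + 1 ≤ l') := by
    intro i
    by_cases hi : S i
    · obtain ⟨l', r', d', e', f', h1, h2, h3, h4, h5⟩ := block_norm hx ht (h.hb i)
      exact ⟨l', r', d', e', f', h1, h2, h3, h5, fun h => absurd hi h, fun _ => h4⟩
    · exact ⟨l i, r i, d i, e i, f i, hlr i, hS i hi, h.hb i, fun U _ h1 h2 => ⟨h1, h2⟩,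
        fun _ => ⟨rfl, rfl, rfl⟩, fun h => absurd h hi⟩
  choose l' r' d' e' f' h1 h2 h3 h4 h5 h6 using key
  have orth : ∀ i j, i ≠ j → e' i ∈ perp Q x (e' j) ∧ e' i ∈ perp Q x (f' j) ∧
      f' i ∈ perp Q x (f' j) := by
    intro i j hij
    have a1 : e i ∈ perp Q x (e j) := h.ee i j hij
    have a2 : e i ∈ perp Q x (f j) := h.ef i j hij
    have a3 : f i ∈ perp Q x (f j) := h.ff i j hij
    have a4 : f i ∈ perp Q x (e j) := (perp_comm hx).2 (h.ef j i hij.symm)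
    obtain ⟨b1, b2⟩ := h4 i _ (perp_stab (e j)) a1 a4
    obtain ⟨b3, b4⟩ := h4 i _ (perp_stab (f j)) a2 a3
    obtain ⟨c1, c2⟩ := h4 j _ (perp_stab (e' i)) ((perp_comm hx).1 b1) ((perp_comm hx).1 b3)
    obtain ⟨c3, c4⟩ := h4 j _ (perp_stab (f' i)) ((perp_comm hx).1 b2) ((perp_comm hx).1 b4)
    exact ⟨(perp_comm hx).1 c1, (perp_comm hx).1 c2, (perp_comm hx).1 c4⟩
  refine ⟨l', r', d', e', f', ⟨⟨fun i => ?_, fun i j hij => (orth i j hij).1,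
    fun i j hij => (orth i j hij).2.2, fun i j hij => (orth i j hij).2.1⟩, h2⟩, h1, h5, h6⟩
  simp only [h1 i]
  exact h3 i

end Frame
end NilOrb

namespace NilOrb
set_option linter.unusedSectionVars false
section Coord
variable {F : Type*} [Field F] [Fintype F] [CharP F 2]
variable {V : Type*} [AddCommGroup V] [Module F V]
variable {Q : QuadraticForm F V} {x : Module.End F V} {n : ℕ}
open QuadraticMap

/-- Index set of half of the basis. -/
abbrev J (m : Fin n → ℕ) : Type := Σ i : Fin n, Fin (m i)

variable {m : Fin n → ℕ} {e f : Fin n → V}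

theorem J.ext' {p q : J m} (h1 : p.1 = q.1) (h2 : (p.2 : ℕ) = q.2) : p = q := by
  rcases p with ⟨i, a⟩
  rcases q with ⟨j, b⟩
  dsimp only at h1
  subst h1
  congr
  exact Fin.ext h2

/-- The reversed index. -/
def J.rev (p : J m) : J m := ⟨p.1, p.2.rev⟩

theorem J.rev_fst (p : J m) : (J.rev p).1 = p.1 := rfl

theorem J.rev_snd (p : J m) : ((J.rev p).2 : ℕ) = m p.1 - 1 - p.2 := by
  simp only [J.rev, Fin.val_rev]; omega

theorem J.card_eq : Fintype.card (J m) = ∑ i, m i := by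
  simp [Fintype.card_sigma]

/-- The vectors of a chain basis. -/
def E (x : Module.End F V) (m : Fin n → ℕ) (e : Fin n → V) (p : J m) : V :=
  (x ^ (p.2 : ℕ)) (e p.1)

/-- The coordinate map of a frame. -/
def T (x : Module.End F V) (m : Fin n → ℕ) (e f : Fin n → V) :
    ((J m → F) × (J m → F)) →ₗ[F] V :=
  LinearMap.coprod (Fintype.linearCombination F (E x m e)) (Fintype.linearCombination F (E x m f))

theorem T_apply (c d : J m → F) :
    T x m e f (c, d) = ∑ p, c p • E x m e p + ∑ p, d p • E x m f p := by
  simp [T, Fintype.linearCombination_apply]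

theorem T_single_left (p : J m) : T x m e f (Pi.single p 1, 0) = E x m e p := by
  rw [T_apply]
  simp [Pi.single_apply]

theorem T_single_right (p : J m) : T x m e f (0, Pi.single p 1) = E x m f p := by
  rw [T_apply]
  simp [Pi.single_apply]

theorem polar_sum_left {ι : Type*} (s : Finset ι) (c : ι → F) (v : ι → V) (w : V) :
    polar Q (∑ p ∈ s, c p • v p) w = ∑ p ∈ s, c p * polar Q (v p) w := by
  classical
  induction s using Finset.induction_on with
  | empty => simp
  | insert a s ha ih =>
    rw [Finset.sum_insert ha, Finset.sum_insert ha, polar_add_left, ih, polar_smul_left,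
      smul_eq_mul]

theorem polar_sum_right {ι : Type*} (s : Finset ι) (c : ι → F) (v : ι → V) (w : V) :
    polar Q w (∑ p ∈ s, c p • v p) = ∑ p ∈ s, c p * polar Q w (v p) := by
  rw [polar_comm, polar_sum_left]
  simp only [polar_comm Q w]

theorem Q_sum_orth {ι : Type*} (s : Finset ι) (c : ι → F) (v : ι → V)
    (h : ∀ p q, polar Q (v p) (v q) = 0) :
    Q (∑ p ∈ s, c p • v p) = ∑ p ∈ s, c p ^ 2 * Q (v p) := by
  classical
  induction s using Finset.induction_on with
  | empty => simp
  | insert a s ha ih =>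
    rw [Finset.sum_insert ha, Finset.sum_insert ha, QuadraticMap.map_add Q, ih, QuadraticMap.map_smul,
      polar_smul_left, polar_sum_right]
    simp [h, pow_two]

theorem T_inj (we wf : J m → V)
    (h1 : ∀ p q, polar Q (E x m e p) (wf q) = if p = q then 1 else 0)
    (h2 : ∀ p q, polar Q (E x m f p) (wf q) = 0)
    (h3 : ∀ p q, polar Q (E x m f p) (we q) = if p = q then 1 else 0)
    (h4 : ∀ p q, polar Q (E x m e p) (we q) = 0) : Function.Injective (T x m e f) := by
  rw [injective_iff_map_eq_zero]
  rintro ⟨c, d⟩ h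
  rw [T_apply] at h
  refine Prod.ext (funext fun q => ?_) (funext fun q => ?_)
  · have := congrArg (fun v => polar Q v (wf q)) h
    simpa [polar_add_left, polar_sum_left, h1, h2] using this
  · have := congrArg (fun v => polar Q v (we q)) h
    simpa [polar_add_left, polar_sum_left, h3, h4] using this

theorem PF.pair (hx : SA Q x) (h : PF Q x m e f) (i j : Fin n) (a b : ℕ) :
    polar Q ((x ^ a) (e i)) ((x ^ b) (f j)) = if i = j ∧ a + b + 1 = m i then 1 else 0 := by
  rw [hx.move, h.ef']

theorem PF.pair' (hx : SA Q x) (h : PF Q x m e f) (i j : Fin n) (a b : ℕ) :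
    polar Q ((x ^ a) (f i)) ((x ^ b) (e j)) = if i = j ∧ a + b + 1 = m i then 1 else 0 := by
  rw [hx.move, h.fe' hx]

theorem PF.T_inj_shift (hx : SA Q x) (h : PF Q x m e f) (k : ℕ) :
    Function.Injective (T x (fun i => m i - k) (fun i => (x ^ k) (e i)) (fun i => (x ^ k) (f i))) := by
  have key : ∀ (p q : J (fun i => m i - k)),
      (p.1 = q.1 ∧ (p.2 : ℕ) + k + (m q.1 - 1 - k - q.2) + 1 = m p.1) ↔ p = q := by
    intro p q
    constructor
    · rintro ⟨h1, h2⟩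
      refine J.ext' h1 ?_
      have h3 : m p.1 = m q.1 := by rw [h1]
      have := q.2.2
      dsimp only at this
      omega
    · rintro rfl
      have := p.2.2
      dsimp only at this
      exact ⟨rfl, by omega⟩
  refine T_inj (Q := Q) (fun q => (x ^ (m q.1 - 1 - k - q.2)) (e q.1))
    (fun q => (x ^ (m q.1 - 1 - k - q.2)) (f q.1)) ?_ ?_ ?_ ?_
  · intro p q
    simp only [E, pow_pow_apply, h.pair hx, key]
  · intro p q
    simp only [E, pow_pow_apply, hx.move, h.ff' hx]
  · intro p q
    simp only [E, pow_pow_apply, h.pair' hx, key]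
  · intro p q
    simp only [E, pow_pow_apply, hx.move, h.ee' hx]

theorem PF.T_inj (hx : SA Q x) (h : PF Q x m e f) : Function.Injective (T x m e f) := by
  have := h.T_inj_shift hx 0
  simpa using this

theorem finrank_coord : Module.finrank F ((J m → F) × (J m → F)) = 2 * ∑ i, m i := by
  rw [Module.finrank_prod, Module.finrank_fintype_fun_eq_card, J.card_eq]; ring

theorem PF.T_bij [FiniteDimensional F V] (hx : SA Q x) (h : PF Q x m e f)
    (hd : Module.finrank F V = 2 * ∑ i, m i) : Function.Bijective (T x m e f) := by
  have hi := h.T_inj hx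
  refine ⟨hi, ?_⟩
  refine (LinearMap.injective_iff_surjective_of_finrank_eq_finrank ?_).1 hi
  rw [finrank_coord, hd]

theorem PF.sum_le [FiniteDimensional F V] (hx : SA Q x) (h : PF Q x m e f) :
    2 * ∑ i, m i ≤ Module.finrank F V := by
  rw [← finrank_coord (F := F) (m := m)]
  exact LinearMap.finrank_le_finrank_of_injective (h.T_inj hx)

theorem PF.Q_T (hx : SA Q x) (h : PF Q x m e f) (k : ℕ) (c d : J m → F) :
    Q ((x ^ k) (T x m e f (c, d))) = ∑ p, c p ^ 2 * Q ((x ^ (k + p.2)) (e p.1)) +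
      ∑ p, d p ^ 2 * Q ((x ^ (k + p.2)) (f p.1)) +
      ∑ p, c p * ∑ q, d q * (if p.1 = q.1 ∧ 2 * k + p.2 + q.2 + 1 = m p.1 then 1 else 0) := by
  rw [T_apply, map_add, QuadraticMap.map_add Q, map_sum (x ^ k), map_sum (x ^ k)]
  simp only [map_smul]
  rw [Q_sum_orth, Q_sum_orth, polar_sum_left]
  · simp only [polar_sum_right, E, pow_pow_apply, h.pair hx]
    congr 1
    refine Finset.sum_congr rfl fun p _ => ?_
    congr 1
    refine Finset.sum_congr rfl fun q _ => ?_
    congr 2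
    rw [show k + p.2 + (k + q.2) + 1 = 2 * k + p.2 + q.2 + 1 by ring]
  · intro p q; simp only [E, pow_pow_apply, hx.move, h.ff' hx]
  · intro p q; simp only [E, pow_pow_apply, hx.move, h.ee' hx]

/-- Range of powers. -/
theorem PF.range_pow (h : PF Q x m e f) (hs : Function.Surjective (T x m e f)) (k : ℕ) :
    LinearMap.range (x ^ k) = LinearMap.range
      (T x (fun i => m i - k) (fun i => (x ^ k) (e i)) (fun i => (x ^ k) (f i))) := by
  apply le_antisymm
  · rintro _ ⟨v, rfl⟩
    obtain ⟨⟨c, d⟩, rfl⟩ := hs v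
    rw [T_apply, map_add, map_sum, map_sum]
    refine Submodule.add_mem _ (Submodule.sum_mem _ fun p _ => ?_)
      (Submodule.sum_mem _ fun p _ => ?_)
    · rw [map_smul]
      refine Submodule.smul_mem _ _ ?_
      by_cases hp : (p.2 : ℕ) < m p.1 - k
      · refine ⟨(Pi.single ⟨p.1, ⟨p.2, hp⟩⟩ 1, 0), ?_⟩
        rw [T_single_left]
        simp only [E, pow_pow_apply, add_comm]
      · rw [E, pow_pow_apply, pow_zero_of_le (h.hb p.1).ze (by omega)]
        exact Submodule.zero_mem _
    · rw [map_smul]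
      refine Submodule.smul_mem _ _ ?_
      by_cases hp : (p.2 : ℕ) < m p.1 - k
      · refine ⟨(0, Pi.single ⟨p.1, ⟨p.2, hp⟩⟩ 1), ?_⟩
        rw [T_single_right]
        simp only [E, pow_pow_apply, add_comm]
      · rw [E, pow_pow_apply, pow_zero_of_le (h.hb p.1).zf (by omega)]
        exact Submodule.zero_mem _
  · rintro _ ⟨⟨c, d⟩, rfl⟩
    rw [T_apply]
    refine Submodule.add_mem _ (Submodule.sum_mem _ fun p _ => ?_)
      (Submodule.sum_mem _ fun p _ => ?_)
    · refine Submodule.smul_mem _ _ ⟨(x ^ (p.2 : ℕ)) (e p.1), ?_⟩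
      simp only [E, pow_pow_apply, add_comm]
    · refine Submodule.smul_mem _ _ ⟨(x ^ (p.2 : ℕ)) (f p.1), ?_⟩
      simp only [E, pow_pow_apply, add_comm]

theorem PF.finrank_range_pow (hx : SA Q x) (h : PF Q x m e f)
    (hs : Function.Surjective (T x m e f)) (k : ℕ) :
    Module.finrank F (LinearMap.range (x ^ k)) = 2 * ∑ i, (m i - k) := by
  rw [h.range_pow hs, LinearMap.finrank_range_of_inj (h.T_inj_shift hx k), finrank_coord]

end Coord
end NilOrb

namespace NilOrb
set_option linter.unusedSectionVars false
section Iso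
variable {F : Type*} [Field F] [Fintype F] [CharP F 2]
variable {V : Type*} [AddCommGroup V] [Module F V]
variable {V' : Type*} [AddCommGroup V'] [Module F V']
variable {Q : QuadraticForm F V} {x : Module.End F V} {n : ℕ}
variable {Q' : QuadraticForm F V'} {x' : Module.End F V'}
open QuadraticMap

theorem GF.iso {t : F} {l r : Fin n → ℕ} {d : Fin n → Bool} {e f : Fin n → V} {e' f' : Fin n → V'}
    (hx : SA Q x) (hx' : SA Q' x')
    (h : GF Q x t l r d e f) (h' : GF Q' x' t l r d e' f')
    (hb : Function.Bijective (T x (fun i => l i + r i) e f))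
    (hb' : Function.Bijective (T x' (fun i => l i + r i) e' f')) :
    ∃ g : V ≃ₗ[F] V', (∀ v, Q' (g v) = Q v) ∧ ∀ v, g (x v) = x' (g v) := by
  set m : Fin n → ℕ := fun i => l i + r i with hm
  let g : V ≃ₗ[F] V' := (LinearEquiv.ofBijective _ hb).symm.trans (LinearEquiv.ofBijective _ hb')
  have hg : ∀ z, g (T x m e f z) = T x' m e' f' z := by
    intro z
    have : (LinearEquiv.ofBijective _ hb).symm (T x m e f z) = z := by
      rw [LinearEquiv.symm_apply_eq]; rfl
    simp only [g, LinearEquiv.trans_apply, this]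
    rfl
  refine ⟨g, fun v => ?_, fun v => ?_⟩
  · obtain ⟨⟨c, d⟩, rfl⟩ := hb.2 v
    rw [hg]
    have h1 := h.pf.Q_T hx 0 c d
    have h2 := h'.pf.Q_T hx' 0 c d
    simp only [pow_zero, Module.End.one_apply] at h1 h2
    rw [h1, h2]
    simp only [(h.nb _).he, (h.nb _).hf, (h'.nb _).he, (h'.nb _).hf]
  · have hE : ∀ i a, g ((x ^ a) (e i)) = (x' ^ a) (e' i) := by
      intro i a
      by_cases ha : a < m i
      · have := hg (Pi.single ⟨i, ⟨a, ha⟩⟩ 1, 0)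
        rwa [T_single_left, T_single_left] at this
      · rw [pow_zero_of_le (h.pf.hb i).ze (not_lt.1 ha), pow_zero_of_le (h'.pf.hb i).ze (not_lt.1 ha),
          map_zero]
    have hF : ∀ i a, g ((x ^ a) (f i)) = (x' ^ a) (f' i) := by
      intro i a
      by_cases ha : a < m i
      · have := hg (0, Pi.single ⟨i, ⟨a, ha⟩⟩ 1)
        rwa [T_single_right, T_single_right] at this
      · rw [pow_zero_of_le (h.pf.hb i).zf (not_lt.1 ha), pow_zero_of_le (h'.pf.hb i).zf (not_lt.1 ha),
          map_zero]
    obtain ⟨⟨c, d⟩, rfl⟩ := hb.2 v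
    simp only [T_apply, map_add, map_sum, map_smul, E, hE, hF]
    congr 1
    · refine Finset.sum_congr rfl fun p _ => ?_
      have := hE p.1 (p.2 + 1)
      simp only [pow_succ', Module.End.mul_apply] at this
      rw [this]
    · refine Finset.sum_congr rfl fun p _ => ?_
      have := hF p.1 (p.2 + 1)
      simp only [pow_succ', Module.End.mul_apply] at this
      rw [this]

/-- A frame transports along an isometry. -/
theorem GF.map {t : F} {l r : Fin n → ℕ} {d : Fin n → Bool} {e f : Fin n → V}
    (h : GF Q x t l r d e f) (g : V ≃ₗ[F] V') (hg : ∀ v, Q' (g v) = Q v)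
    (hgx : ∀ v, g (x v) = x' (g v)) :
    GF Q' x' t l r d (fun i => g (e i)) (fun i => g (f i)) := by
  have hp : ∀ a v, (x' ^ a) (g v) = g ((x ^ a) v) := by
    intro a
    induction a with
    | zero => intro v; simp
    | succ a ih => intro v; rw [pow_succ', pow_succ', Module.End.mul_apply, Module.End.mul_apply, ih, hgx]
  have hpol : ∀ v w, polar Q' (g v) (g w) = polar Q v w := by
    intro v w
    simp only [polar, ← map_add, hg]
  refine ⟨⟨fun i => ⟨fun a => ?_, ?_, ?_⟩, fun i j hij a => ?_, fun i j hij a => ?_,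
    fun i j hij a => ?_⟩, fun i => ⟨(h.nb i).le, (h.nb i).hd, fun a => ?_, fun a => ?_⟩⟩
  · rw [hp, hpol, (h.pf.hb i).ef]
  · rw [hp, (h.pf.hb i).ze, map_zero]
  · rw [hp, (h.pf.hb i).zf, map_zero]
  · rw [hp, hpol, h.pf.ee i j hij]
  · rw [hp, hpol, h.pf.ff i j hij]
  · rw [hp, hpol, h.pf.ef i j hij]
  · rw [hp, hg, (h.nb i).he]
  · rw [hp, hg, (h.nb i).hf]

end Iso

section Gauss
variable {F : Type*} [Field F] [Fintype F] [CharP F 2]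
variable {V : Type*} [AddCommGroup V] [Module F V] [Fintype V]
variable {Q : QuadraticForm F V} {x : Module.End F V} {n : ℕ}
open QuadraticMap

theorem psi_sum {ι : Type*} (s : Finset ι) (c : ι → F) :
    psi (∑ p ∈ s, c p) = ∏ p ∈ s, psi (c p) := by
  classical
  induction s using Finset.induction_on with
  | empty => simp [psi_zero]
  | insert a s ha ih => rw [Finset.sum_insert ha, Finset.prod_insert ha, psi_add, ih]

open Classical in
theorem psi_line_sum (y : F) : ∑ c : F, psi (c * y) = if y = 0 then (Fintype.card F : ℤ) else 0 := by
  split_ifs with h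
  · subst h; simp [psi_zero]
  · obtain ⟨b, hb⟩ : ∃ b, psi (b * y) ≠ 1 := by
      by_contra hcon
      push Not at hcon
      exact h (eq_zero_of_psi_line hcon)
    have h1 : ∑ c : F, psi (c * y) = ∑ c : F, psi ((c + b) * y) :=
      (Fintype.sum_equiv (Equiv.addRight b) _ _ (fun c => rfl)).symm
    have hb' : psi (b * y) = -1 := (psi_eq_or _).resolve_left hb
    simp only [add_mul, psi_add, hb', mul_neg, mul_one, Finset.sum_neg_distrib] at h1
    omega

open Classical in
theorem psi_fun_sum {ι : Type*} [Fintype ι] [DecidableEq ι] (lam : ι → F) :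
    ∑ c : ι → F, psi (∑ p, c p * lam p) =
      if ∀ p, lam p = 0 then (Fintype.card F : ℤ) ^ (Fintype.card ι) else 0 := by
  simp only [psi_sum]
  have := (Finset.prod_univ_sum (fun _ : ι => (Finset.univ : Finset F))
    (fun p c => psi (c * lam p))).symm
  rw [Fintype.piFinset_univ] at this
  rw [this]
  simp only [psi_line_sum]
  split_ifs with h
  · simp [h]
  · push Not at h
    obtain ⟨p, hp⟩ := h
    exact Finset.prod_eq_zero (Finset.mem_univ p) (by simp [hp])

theorem psi_sq_sum {ι : Type*} (s : Finset ι) (c : ι → F) (P : ι → Prop) [DecidablePred P] (z : F) :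
    psi ((∑ p ∈ s, c p ^ 2 * (if P p then 1 else 0)) + z) =
      psi ((∑ p ∈ s, c p * (if P p then 1 else 0)) + z) := by
  have : (∑ p ∈ s, c p ^ 2 * (if P p then (1:F) else 0)) =
      (∑ p ∈ s, c p * (if P p then (1:F) else 0)) ^ 2 := by
    rw [CharTwo.sum_sq]
    refine Finset.sum_congr rfl fun p _ => ?_
    split_ifs <;> simp
  rw [this, psi_sq_add]

open Classical in
/-- The Gauss sum of `Q ∘ x^k`. -/
theorem GF.gauss {t : F} {l r : Fin n → ℕ} {d : Fin n → Bool} {e f : Fin n → V}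
    (hx : SA Q x) (h : GF Q x t l r d e f)
    (hb : Function.Bijective (T x (fun i => l i + r i) e f)) (k : ℕ)
    (hk : ∀ j, k < l j → k ≤ r j) :
    ∃ N : ℕ, 0 < N ∧ ∑ v, psi (Q ((x ^ k) v)) =
      N * psi (∑ j, if k ≤ r j ∧ d j = true then t else 0) := by
  set m : Fin n → ℕ := fun i => l i + r i with hm
  let lam : (J m → F) → J m → F := fun b p =>
    (if k + p.2 + 1 = l p.1 ∧ r p.1 < l p.1 then 1 else 0) +
    ∑ q, b q * (if p.1 = q.1 ∧ 2 * k + p.2 + q.2 + 1 = m p.1 then 1 else 0)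
  have hsum : ∑ v, psi (Q ((x ^ k) v)) =
      ∑ b : J m → F, psi (∑ p, b p ^ 2 * Q ((x ^ (k + p.2)) (f p.1))) *
        (if ∀ p, lam b p = 0 then (Fintype.card F : ℤ) ^ (Fintype.card (J m)) else 0) := by
    have h1 : ∑ v, psi (Q ((x ^ k) v)) = ∑ z : (J m → F) × (J m → F),
        psi (Q ((x ^ k) (T x m e f z))) :=
      (Fintype.sum_equiv (Equiv.ofBijective _ hb) _ _ (fun _ => rfl)).symm
    rw [h1, Fintype.sum_prod_type_right]
    refine Finset.sum_congr rfl fun b _ => ?_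
    rw [← psi_fun_sum (lam b), Finset.mul_sum]
    refine Finset.sum_congr rfl fun c _ => ?_
    rw [h.pf.Q_T hx, ← psi_add]
    simp only [(h.nb _).he, lam, mul_add, Finset.sum_add_distrib]
    rw [add_assoc, psi_sq_sum]
    congr 1
    ring
  have hval : ∀ b : J m → F, (∀ p, lam b p = 0) →
      ∑ p, b p ^ 2 * Q ((x ^ (k + p.2)) (f p.1)) = ∑ j, if k ≤ r j ∧ d j = true then t else 0 := by
    intro b hb'
    simp only [(h.nb _).hf]
    rw [Fintype.sum_sigma]
    refine Finset.sum_congr rfl fun j _ => ?_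
    by_cases hj : k ≤ r j ∧ d j = true
    · rw [if_pos hj]
      have hlt : r j < l j := by
        rcases (h.nb j).le.lt_or_eq with h1 | h1
        · exact h1
        · rw [(h.nb j).hd h1] at hj; simp at hj
      have hlt2 : r j - k < m j := by simp only [hm]; omega
      have hlt3 : l j - 1 - k < m j := by simp only [hm]; omega
      rw [Finset.sum_eq_single (⟨r j - k, hlt2⟩ : Fin (m j))]
      · have h2 := hb' ⟨j, ⟨l j - 1 - k, hlt3⟩⟩
        simp only [lam] at h2
        rw [if_pos ⟨by omega, hlt⟩, Finset.sum_eq_single (⟨j, ⟨r j - k, hlt2⟩⟩ : J m)] at h2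
        · rw [if_pos ⟨rfl, by simp only [hm]; omega⟩, mul_one] at h2
          have h3 : b ⟨j, ⟨r j - k, hlt2⟩⟩ = 1 := (CharTwo.add_eq_zero.1 h2).symm
          rw [h3, if_pos ⟨by simp only []; omega, hlt, hj.2⟩]; simp
        · intro q _ hq
          rw [if_neg, mul_zero]
          rintro ⟨h4, h5⟩
          apply hq
          refine J.ext' h4.symm ?_
          simp only [hm] at h5 ⊢
          omega
        · simp
      · intro a _ ha
        rw [if_neg, mul_zero]
        rintro ⟨h4, -⟩
        apply ha
        apply Fin.ext
        dsimp only at h4 ⊢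
        omega
      · simp
    · rw [if_neg hj]
      refine Finset.sum_eq_zero fun a _ => ?_
      rw [if_neg, mul_zero]
      rintro ⟨h4, h5, h6⟩
      exact hj ⟨by simp only at h4; omega, h6⟩
  have hsurv : ∀ p, lam (fun q => if k + q.2 = r q.1 ∧ r q.1 < l q.1 then 1 else 0) p = 0 := by
    intro p
    simp only [lam]
    by_cases hp : k + p.2 + 1 = l p.1 ∧ r p.1 < l p.1
    · have h3 := hk p.1 (by omega)
      have hlt2 : r p.1 - k < m p.1 := by simp only [hm]; omega
      rw [if_pos hp, Finset.sum_eq_single (⟨p.1, ⟨r p.1 - k, hlt2⟩⟩ : J m)]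
      · rw [if_pos ⟨by simp only; omega, hp.2⟩, if_pos ⟨rfl, by simp only [hm]; omega⟩, mul_one,
          CharTwo.add_self_eq_zero]
      · intro q _ hq
        by_cases h4 : p.1 = q.1 ∧ 2 * k + p.2 + q.2 + 1 = m p.1
        · exfalso
          apply hq
          refine J.ext' h4.1.symm ?_
          have := h4.2
          simp only [hm] at this ⊢
          omega
        · rw [if_neg h4, mul_zero]
      · simp
    · rw [if_neg hp, zero_add]
      refine Finset.sum_eq_zero fun q _ => ?_
      by_cases h4 : p.1 = q.1 ∧ 2 * k + p.2 + q.2 + 1 = m p.1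
      · rw [if_neg, zero_mul]
        rintro ⟨h5, h6⟩
        obtain ⟨h7, h8⟩ := h4
        apply hp
        have e1 : r p.1 = r q.1 := by rw [h7]
        have e2 : l p.1 = l q.1 := by rw [h7]
        simp only [hm] at h8
        omega
      · rw [if_neg h4, mul_zero]
  refine ⟨(Finset.univ.filter fun b => ∀ p, lam b p = 0).card *
    (Fintype.card F) ^ (Fintype.card (J m)), ?_, ?_⟩
  · refine Nat.mul_pos (Finset.card_pos.2 ⟨_, Finset.mem_filter.2 ⟨Finset.mem_univ _, hsurv⟩⟩) ?_
    exact Nat.pow_pos Fintype.card_pos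
  · rw [hsum]
    have : ∀ b : J m → F, psi (∑ p, b p ^ 2 * Q ((x ^ (k + p.2)) (f p.1))) *
        (if ∀ p, lam b p = 0 then (Fintype.card F : ℤ) ^ (Fintype.card (J m)) else 0) =
        if ∀ p, lam b p = 0 then psi (∑ j, if k ≤ r j ∧ d j = true then t else 0) *
          (Fintype.card F : ℤ) ^ (Fintype.card (J m)) else 0 := by
      intro b
      split_ifs with h1
      · rw [hval b h1]
      · simp
    simp only [this]
    rw [← Finset.sum_filter, Finset.sum_const, nsmul_eq_mul]
    push_cast
    ring

end Gauss
end NilOrb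

namespace NilOrb
set_option linter.unusedSectionVars false
section Exist
variable {F : Type*} [Field F] [Fintype F] [CharP F 2]
variable {V : Type*} [AddCommGroup V] [Module F V]
variable {Q : QuadraticForm F V} {x : Module.End F V} {n : ℕ}
variable {m : Fin n → ℕ} {e f : Fin n → V}
open QuadraticMap

theorem J.rev_rev (p : J m) : J.rev (J.rev p) = p := by
  simp [J.rev]

/-- The common annihilator of a partial frame. -/
def UU (Q : QuadraticForm F V) (x : Module.End F V) (e f : Fin n → V) : Submodule F V :=
  ⨅ i, (perp Q x (e i) ⊓ perp Q x (f i))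

theorem mem_UU {v : V} : v ∈ UU Q x e f ↔ ∀ i, v ∈ perp Q x (e i) ∧ v ∈ perp Q x (f i) := by
  simp [UU, Submodule.mem_iInf]

theorem UU_stab : Stab x (UU Q x e f) := by
  intro v hv
  rw [mem_UU] at hv ⊢
  exact fun i => ⟨perp_stab _ _ (hv i).1, perp_stab _ _ (hv i).2⟩

theorem UU_T (hx : SA Q x) {v : V} (hv : v ∈ UU Q x e f) (a : ℕ) (z : (J m → F) × (J m → F)) :
    polar Q ((x ^ a) v) (T x m e f z) = 0 := by
  rcases z with ⟨c, d⟩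
  rw [mem_UU] at hv
  rw [T_apply, polar_add_right, polar_sum_right, polar_sum_right]
  have h1 : ∀ i b, polar Q ((x ^ a) v) ((x ^ b) (e i)) = 0 := by
    intro i b; rw [hx.move]; exact (hv i).1 _
  have h2 : ∀ i b, polar Q ((x ^ a) v) ((x ^ b) (f i)) = 0 := by
    intro i b; rw [hx.move]; exact (hv i).2 _
  simp [E, h1, h2]

theorem PF.proj (hx : SA Q x) (h : PF Q x m e f) (v : V) :
    ∃ z, v + T x m e f z ∈ UU Q x e f := by
  refine ⟨(fun p => polar Q v (E x m f (J.rev p)), fun p => polar Q v (E x m e (J.rev p))), ?_⟩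
  rw [mem_UU]
  have key : ∀ (p q : J m), (p.1 = q.1 ∧ (p.2 : ℕ) + q.2 + 1 = m p.1) ↔ p = J.rev q := by
    intro p q
    constructor
    · rintro ⟨h1, h2⟩
      refine J.ext' h1 ?_
      have h3 : m p.1 = m q.1 := by rw [h1]
      rw [J.rev_snd]
      omega
    · rintro rfl
      have := q.2.2
      rw [J.rev_snd, J.rev_fst]
      exact ⟨rfl, by omega⟩
  intro i
  constructor
  · intro a
    by_cases ha : a < m i
    · rw [hx.pow_symm, polar_add_left, T_apply, polar_add_left, polar_sum_left, polar_sum_left]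
      have h1 : ∀ p : J m, polar Q (E x m e p) ((x ^ a) (e i)) = 0 := by
        intro p; rw [E, hx.move, h.ee' hx]
      have h2 : ∀ p : J m, polar Q (E x m f p) ((x ^ a) (e i)) =
          if p = J.rev ⟨i, ⟨a, ha⟩⟩ then 1 else 0 := by
        intro p; rw [E, h.pair' hx]
        simp only [← key]
      simp only [h1, h2, J.rev_rev, mul_zero, mul_ite, mul_one, Finset.sum_const_zero,
        Finset.sum_ite_eq', Finset.mem_univ, if_true, zero_add, add_zero]
      exact CharTwo.add_self_eq_zero _
    · rw [hx.pow_symm, pow_zero_of_le (h.hb i).ze (not_lt.1 ha)]; simp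
  · intro a
    by_cases ha : a < m i
    · rw [hx.pow_symm, polar_add_left, T_apply, polar_add_left, polar_sum_left, polar_sum_left]
      have h1 : ∀ p : J m, polar Q (E x m f p) ((x ^ a) (f i)) = 0 := by
        intro p; rw [E, hx.move, h.ff' hx]
      have h2 : ∀ p : J m, polar Q (E x m e p) ((x ^ a) (f i)) =
          if p = J.rev ⟨i, ⟨a, ha⟩⟩ then 1 else 0 := by
        intro p; rw [E, h.pair hx]
        simp only [← key]
      simp only [h1, h2, J.rev_rev, mul_zero, mul_ite, mul_one, Finset.sum_const_zero,
        Finset.sum_ite_eq', Finset.mem_univ, if_true, zero_add, add_zero]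
      exact CharTwo.add_self_eq_zero _
    · rw [hx.pow_symm, pow_zero_of_le (h.hb i).zf (not_lt.1 ha)]; simp

theorem PF.extend [FiniteDimensional F V] (hx : SA Q x) (hnil : IsNilpotent x)
    (hnd : ∀ v, (∀ w, polar Q v w = 0) → v = 0)
    (hdim : Module.finrank F V = 2 * n) (h : PF Q x m e f) (hlt : ∑ i, m i < n) :
    ∃ (m' : Fin n → ℕ) (e' f' : Fin n → V), PF Q x m' e' f' ∧ ∑ i, m i < ∑ i, m' i := by
  classical
  obtain ⟨i0, hi0⟩ : ∃ i, m i = 0 := by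
    by_contra hcon
    push Not at hcon
    have : ∑ i : Fin n, 1 ≤ ∑ i, m i := Finset.sum_le_sum fun i _ => Nat.one_le_iff_ne_zero.2 (hcon i)
    simp at this
    omega
  obtain ⟨v0, hv0⟩ : ∃ v, v ∉ LinearMap.range (T x m e f) := by
    by_contra hcon
    push Not at hcon
    have h1 : LinearMap.range (T x m e f) = ⊤ := by
      rw [eq_top_iff]; exact fun v _ => hcon v
    have h2 := LinearMap.finrank_range_of_inj (h.T_inj hx)
    rw [h1, finrank_top, finrank_coord, hdim] at h2
    omega
  obtain ⟨z0, hz0⟩ := h.proj hx v0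
  have hu0 : v0 + T x m e f z0 ≠ 0 := by
    intro hc
    apply hv0
    refine ⟨-z0, ?_⟩
    rw [map_neg]
    exact (eq_neg_of_add_eq_zero_left hc).symm
  obtain ⟨N, hN⟩ := hnil
  have hex : ∃ k, ∀ u ∈ UU Q x e f, (x ^ k) u = 0 := ⟨N, fun u _ => by rw [hN]; simp⟩
  let m0 := Nat.find hex
  have hm0 : ∀ u ∈ UU Q x e f, (x ^ m0) u = 0 := Nat.find_spec hex
  have hm1 : 1 ≤ m0 := by
    by_contra hc
    have h0 : m0 = 0 := by omega
    have := hm0 _ hz0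
    rw [h0] at this
    exact hu0 (by simpa using this)
  have hm2 : ¬ ∀ u ∈ UU Q x e f, (x ^ (m0 - 1)) u = 0 := Nat.find_min hex (by omega)
  push Not at hm2
  obtain ⟨u, huU, hu⟩ := hm2
  obtain ⟨w, hw⟩ : ∃ w, polar Q ((x ^ (m0 - 1)) u) w ≠ 0 := by
    by_contra hcon
    push Not at hcon
    exact hu (hnd _ hcon)
  obtain ⟨z1, hz1⟩ := h.proj hx w
  have hw1 : polar Q ((x ^ (m0 - 1)) u) (w + T x m e f z1) ≠ 0 := by
    rwa [polar_add_right, UU_T hx huU, add_zero]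
  obtain ⟨w', hw'U, hw'p, -, -⟩ := f_norm hx hm1
    (fun a ha => by rw [pow_zero_of_le (hm0 u huU) ha]; simp) hw1
  have hwU := hw'U _ UU_stab hz1
  have hu' := mem_UU.1 huU
  have hw'' := mem_UU.1 hwU
  have hup : ∀ {g : Fin n → V} {y : V} {i : Fin n}, i ≠ i0 → Function.update g i0 y i = g i :=
    fun hi => Function.update_of_ne hi _ _
  have hupm : ∀ {y : ℕ} {i : Fin n}, i ≠ i0 → Function.update m i0 y i = m i :=
    fun hi => Function.update_of_ne hi _ _
  refine ⟨Function.update m i0 m0, Function.update e i0 u, Function.update f i0 w', 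
    ⟨fun i => ?_, fun i j hij a => ?_, fun i j hij a => ?_, fun i j hij a => ?_⟩, ?_⟩
  · by_cases hi : i = i0
    · subst hi
      simp only [Function.update_self]
      exact ⟨hw'p, hm0 u huU, hm0 w' hwU⟩
    · rw [hup hi, hup hi, hupm hi]
      exact h.hb i
  · by_cases hi : i = i0
    · subst hi
      rw [Function.update_self, hup hij.symm]; exact (hu' j).1 a
    · by_cases hj : j = i0
      · subst hj
        rw [Function.update_self, hup hij, hx.comm']; exact (hu' i).1 a
      · rw [hup hi, hup hj, h.ee i j hij]
  · by_cases hi : i = i0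
    · subst hi
      rw [Function.update_self, hup hij.symm]; exact (hw'' j).2 a
    · by_cases hj : j = i0
      · subst hj
        rw [Function.update_self, hup hij, hx.comm']; exact (hw'' i).2 a
      · rw [hup hi, hup hj, h.ff i j hij]
  · by_cases hi : i = i0
    · subst hi
      rw [Function.update_self, hup hij.symm]; exact (hu' j).2 a
    · by_cases hj : j = i0
      · subst hj
        rw [Function.update_self, hup hij, hx.comm']; exact (hw'' i).1 a
      · rw [hup hi, hup hj, h.ef i j hij]
  · refine Finset.sum_lt_sum (fun i _ => ?_) ⟨i0, Finset.mem_univ _, ?_⟩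
    · by_cases hi : i = i0
      · subst hi; omega
      · rw [hupm hi]
    · rw [Function.update_self]; omega

theorem exists_PF [FiniteDimensional F V] (hx : SA Q x) (hnil : IsNilpotent x)
    (hnd : ∀ v, (∀ w, polar Q v w = 0) → v = 0)
    (hdim : Module.finrank F V = 2 * n) :
    ∃ (m : Fin n → ℕ) (e f : Fin n → V), PF Q x m e f ∧ ∑ i, m i = n := by
  have key : ∀ k, k ≤ n → ∃ (m : Fin n → ℕ) (e f : Fin n → V), PF Q x m e f ∧ k ≤ ∑ i, m i := by
    intro k
    induction k with
    | zero =>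
      intro _
      refine ⟨0, 0, 0, ⟨fun i => ⟨fun a => ?_, ?_, ?_⟩, ?_, ?_, ?_⟩, Nat.zero_le _⟩ <;> simp
    | succ k ih =>
      intro hk
      obtain ⟨m, e, f, h, hs⟩ := ih (by omega)
      by_cases h1 : k + 1 ≤ ∑ i, m i
      · exact ⟨m, e, f, h, h1⟩
      · obtain ⟨m', e', f', h', hs'⟩ := h.extend hx hnil hnd hdim (by omega)
        exact ⟨m', e', f', h', by omega⟩
  obtain ⟨m, e, f, h, hs⟩ := key n le_rfl
  have := h.sum_le hx
  exact ⟨m, e, f, h, by omega⟩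

/-- Initial good frame, with sorted block sizes. -/
theorem exists_GF [FiniteDimensional F V] (hx : SA Q x) (hnil : IsNilpotent x)
    (hnd : ∀ v, (∀ w, polar Q v w = 0) → v = 0)
    (hdim : Module.finrank F V = 2 * n) {t : F} (ht : t ∉ asP F) :
    ∃ (l r : Fin n → ℕ) (d : Fin n → Bool) (e f : Fin n → V), GF Q x t l r d e f ∧
      ∑ i, (l i + r i) = n ∧ Antitone (fun i => l i + r i) := by
  obtain ⟨m, e, f, h, hs⟩ := exists_PF hx hnil hnd hdim
  let s := Tuple.sort (fun i => OrderDual.toDual (m i))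
  have hmono : Antitone (m ∘ s) := by
    have := Tuple.monotone_sort (fun i => OrderDual.toDual (m i))
    intro i j hij
    exact this hij
  obtain ⟨l, r, d, e', f', h1, h2, -, -⟩ := (h.perm s).normalize hx ht (fun _ => True)
    (m ∘ s) 0 (fun _ => false) (fun i => by simp) (fun i hi => absurd trivial hi)
  refine ⟨l, r, d, e', f', h1, ?_, ?_⟩
  · simp only [h2]
    exact (Equiv.sum_comp s m).trans hs
  · intro i j hij
    simp only [h2]
    exact hmono hij

end Exist
end NilOrb

namespace NilOrb
set_option linter.unusedSectionVars false
section Red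
variable {F : Type*} [Field F] [Fintype F] [CharP F 2]
variable {V : Type*} [AddCommGroup V] [Module F V]
variable {Q : QuadraticForm F V} {x : Module.End F V} {n : ℕ}
variable {m : Fin n → ℕ} {e f : Fin n → V}
open QuadraticMap

theorem PF.swapAll (hx : SA Q x) (h : PF Q x m e f) : PF Q x m f e := by
  simpa using h.swap hx (fun _ => True)

theorem PF.transv2 (hx : SA Q x) (h : PF Q x m e f) {i j : Fin n} (hij : i ≠ j) (hm : m j ≤ m i)
    (c : F) (u : ℕ) :
    PF Q x m (Function.update e j (e j + c • (x ^ (u + (m i - m j))) (e i)))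
      (Function.update f i (f i + c • (x ^ u) (f j))) :=
  ((h.swapAll hx).transv hx hij hm c u).swapAll hx

theorem PF.transv3 (hx : SA Q x) (h : PF Q x m e f) {i j : Fin n} (hij : i ≠ j) (hm : m j ≤ m i)
    (c : F) (u : ℕ) :
    PF Q x m e (Function.update (Function.update f j (f j + c • (x ^ (u + (m i - m j))) (e i))) i
      (f i + c • (x ^ u) (e j))) := by
  classical
  have h1 := ((h.swap hx (fun p => p = i)).transv hx hij hm c u).swap hx (fun p => p = i)
  convert h1 using 1
  · funext p
    by_cases hp : p = i
    · subst hp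
      simp [hij]
    · simp [hp]
  · funext p
    by_cases hp : p = i
    · subst hp
      simp [hij.symm]
    · by_cases hq : p = j
      · subst hq; simp [hp]
      · simp [hp, hq]

theorem Q_add_pol {v w : V} (h : polar Q v w = 0) : Q (v + w) = Q v + Q w := by
  rw [QuadraticMap.map_add Q, h, add_zero]

theorem PF.Q_e_add_e (hx : SA Q x) (h : PF Q x m e f) (i j : Fin n) (a u : ℕ) (c : F) :
    Q ((x ^ a) (e i + c • (x ^ u) (e j))) =
      Q ((x ^ a) (e i)) + c * c * Q ((x ^ (a + u)) (e j)) := by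
  rw [map_add, Q_add_pol, map_smul, QuadraticMap.map_smul, pow_pow_apply, smul_eq_mul]
  rw [map_smul, pow_pow_apply, polar_smul_right, hx.move, h.ee' hx, smul_zero]

theorem PF.Q_f_add_e (hx : SA Q x) (h : PF Q x m e f) {i j : Fin n} (hij : i ≠ j) (a u : ℕ) (c : F) :
    Q ((x ^ a) (f i + c • (x ^ u) (e j))) =
      Q ((x ^ a) (f i)) + c * c * Q ((x ^ (a + u)) (e j)) := by
  rw [map_add, Q_add_pol, map_smul, QuadraticMap.map_smul, pow_pow_apply, smul_eq_mul]
  rw [map_smul, pow_pow_apply, polar_smul_right, hx.move, h.fe' hx, if_neg (by tauto), smul_zero]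

/-- Normal form data. -/
structure NF (l r : Fin n → ℕ) (d : Fin n → Bool) : Prop where
  al : Antitone l
  ar : Antitone r
  le : ∀ i, r i ≤ l i
  hd : ∀ i, r i = l i → d i = false
  hij : ∀ i j, i < j → r i < l j → d i = false

theorem GF.qe {t : F} {l r : Fin n → ℕ} {d : Fin n → Bool} (h : GF Q x t l r d e f) {i : Fin n}
    (hi : r i < l i) : Q ((x ^ (l i - 1)) (e i)) = 1 := by
  rw [(h.nb i).he, if_pos ⟨by omega, hi⟩]

theorem GF.qe0 {t : F} {l r : Fin n → ℕ} {d : Fin n → Bool} (h : GF Q x t l r d e f) {i : Fin n}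
    {a : ℕ} (hi : a + 1 ≠ l i) : Q ((x ^ a) (e i)) = 0 := by
  rw [(h.nb i).he, if_neg (fun hh => hi hh.1)]

theorem GF.red1 (hx : SA Q x) {t : F} (ht : t ∉ asP F) {l r : Fin n → ℕ} {d : Fin n → Bool}
    (h : GF Q x t l r d e f) {i j : Fin n} (hij : i ≠ j) (hm : l j + r j ≤ l i + r i)
    (hl : l i < l j) :
    ∃ (l' r' : Fin n → ℕ) (d' : Fin n → Bool) (e' f' : Fin n → V), GF Q x t l' r' d' e' f' ∧
      (∀ p, l' p + r' p = l p + r p) ∧ ∑ p, l p < ∑ p, l' p := by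
  have hri := (h.nb i).le
  have hrj : r j < l j := by omega
  have h1 := h.pf.transv hx hij hm 1 0
  obtain ⟨l', r', d', e', f', a1, a2, a3, a4⟩ := h1.normalize hx ht (fun p => p = i ∨ p = j) l r d
    (fun _ => rfl) (by
      intro p hp
      push Not at hp
      rw [Function.update_of_ne hp.1, Function.update_of_ne hp.2]
      exact h.nb p)
  refine ⟨l', r', d', e', f', a1, a2, ?_⟩
  have b1 : l j ≤ l' i := by
    have := a4 i (Or.inl rfl) (l j - 1)
    rw [Function.update_self, h.pf.Q_e_add_e hx, add_zero, h.qe hrj, h.qe0 (by omega)] at this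
    have := this (by simp)
    omega
  have b2 : l j ≤ l' j := by
    have := a4 j (Or.inr rfl) (l j - 1)
    rw [Function.update_of_ne hij.symm, h.qe hrj] at this
    have := this (by simp)
    omega
  refine Finset.sum_lt_sum (fun p _ => ?_) ⟨i, Finset.mem_univ _, by omega⟩
  by_cases hp : p = i
  · subst hp; omega
  · by_cases hq : p = j
    · subst hq; omega
    · exact (a3 p (by tauto)).1.ge

theorem GF.red2 (hx : SA Q x) {t : F} (ht : t ∉ asP F) {l r : Fin n → ℕ} {d : Fin n → Bool}
    (h : GF Q x t l r d e f) {i j : Fin n} (hij : i ≠ j) (hm : l j + r j ≤ l i + r i)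
    (hl : r i < r j) :
    ∃ (l' r' : Fin n → ℕ) (d' : Fin n → Bool) (e' f' : Fin n → V), GF Q x t l' r' d' e' f' ∧
      (∀ p, l' p + r' p = l p + r p) ∧ ∑ p, l p < ∑ p, l' p := by
  have hrj := (h.nb j).le
  have hri : r i < l i := by omega
  have h1 := h.pf.transv2 hx hij hm 1 0
  obtain ⟨l', r', d', e', f', a1, a2, a3, a4⟩ := h1.normalize hx ht (fun p => p = i ∨ p = j) l r d
    (fun _ => rfl) (by
      intro p hp
      push Not at hp
      rw [Function.update_of_ne hp.1, Function.update_of_ne hp.2]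
      exact h.nb p)
  refine ⟨l', r', d', e', f', a1, a2, ?_⟩
  have b1 : l i ≤ l' i := by
    have := a4 i (Or.inl rfl) (l i - 1)
    rw [Function.update_of_ne hij, h.qe hri] at this
    have := this (by simp)
    omega
  have b2 : l j < l' j := by
    have := a4 j (Or.inr rfl) (l j + r j - r i - 1)
    rw [Function.update_self, h.pf.Q_e_add_e hx, h.qe0 (i := j) (by omega),
      show l j + r j - r i - 1 + (0 + (l i + r i - (l j + r j))) = l i - 1 by omega,
      h.qe hri] at this
    have := this (by simp)
    omega
  refine Finset.sum_lt_sum (fun p _ => ?_) ⟨j, Finset.mem_univ _, by omega⟩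
  by_cases hp : p = i
  · subst hp; omega
  · by_cases hq : p = j
    · subst hq; omega
    · exact (a3 p (by tauto)).1.ge

theorem GF.red3 (hx : SA Q x) {t : F} (ht : t ∉ asP F) {l r : Fin n → ℕ} {d : Fin n → Bool}
    (h : GF Q x t l r d e f) {i j : Fin n} (hij : i ≠ j) (hm : l j + r j ≤ l i + r i)
    (hr : r j ≤ r i) (hl : r i < l j) (hd : d i = true) :
    ∃ (l' r' : Fin n → ℕ) (d' : Fin n → Bool) (e' f' : Fin n → V), GF Q x t l' r' d' e' f' ∧
      (∀ p, l' p + r' p = l p + r p) ∧ (∀ p, l p ≤ l' p) ∧ d' i = false ∧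
      (∀ p, p ≠ i → p ≠ j → d' p = d p) := by
  have hri : r i < l i := by
    rcases (h.nb i).le.lt_or_eq with h1 | h1
    · exact h1
    · rw [(h.nb i).hd h1] at hd; simp at hd
  obtain ⟨c, hc⟩ := exists_sqrt t
  have hcc : c * c = t := by rw [← hc]; ring
  have h1 := h.pf.transv3 hx hij hm c (l j - 1 - r i)
  obtain ⟨l', r', d', e', f', a1, a2, a3, a4⟩ := h1.normalize hx ht (fun p => p = j) l r
    (Function.update d i false)
    (fun _ => rfl) (by
      intro p hp
      by_cases hp2 : p = i
      · subst hp2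
        rw [Function.update_self, Function.update_self]
        refine ⟨(h.nb p).le, fun _ => rfl, (h.nb p).he, fun a => ?_⟩
        rw [h.pf.Q_f_add_e hx hij, (h.nb p).hf, (h.nb j).he, hcc]
        by_cases ha : a = r p
        · rw [if_pos ⟨ha, hri, hd⟩, if_pos ⟨by omega, by omega⟩, mul_one,
            CharTwo.add_self_eq_zero]; simp
        · rw [if_neg (by tauto), if_neg (by omega)]; simp
      · rw [Function.update_of_ne hp2, Function.update_of_ne hp2, Function.update_of_ne hp]
        exact h.nb p)
  refine ⟨l', r', d', e', f', a1, a2, fun p => ?_, ?_, fun p hp hq => ?_⟩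
  · by_cases hp : p = j
    · subst hp
      have := a4 p rfl (l p - 1)
      rw [h.qe (by omega)] at this
      have := this (by simp)
      omega
    · exact (a3 p hp).1.ge
  · have := (a3 i hij).2.2
    rwa [Function.update_self] at this
  · have := (a3 p hq).2.2
    rwa [Function.update_of_ne hp] at this

/-- Weight of the discriminant part. -/
def Dw (d : Fin n → Bool) : ℕ := ∑ i, if d i = true then 2 ^ (n - (i : ℕ)) else 0

theorem Dw_lt {d d' : Fin n → Bool} {i j : Fin n} (hij : i < j) (hd : d i = true)
    (hd' : d' i = false) (h : ∀ p, p ≠ i → p ≠ j → d' p = d p) : Dw d' < Dw d := by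
  have hij' : j ≠ i := hij.ne'
  have hs : ∀ b : Fin n → Bool, Dw b = (if b i = true then 2 ^ (n - (i : ℕ)) else 0) +
      ((if b j = true then 2 ^ (n - (j : ℕ)) else 0) +
      ∑ p ∈ (Finset.univ.erase i).erase j, if b p = true then 2 ^ (n - (p : ℕ)) else 0) := by
    intro b
    rw [Dw, ← Finset.add_sum_erase _ _ (Finset.mem_univ i),
      ← Finset.add_sum_erase (Finset.univ.erase i) _ (Finset.mem_erase.2 ⟨hij', Finset.mem_univ j⟩)]
  have hrest : ∑ p ∈ (Finset.univ.erase i).erase j, (if d' p = true then 2 ^ (n - (p : ℕ)) else 0) =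
      ∑ p ∈ (Finset.univ.erase i).erase j, (if d p = true then 2 ^ (n - (p : ℕ)) else 0) := by
    refine Finset.sum_congr rfl fun p hp => ?_
    simp only [Finset.mem_erase] at hp
    rw [h p hp.2.1 hp.1]
  rw [hs, hs, hrest, hd, hd']
  have : 2 ^ (n - (j : ℕ)) < 2 ^ (n - (i : ℕ)) :=
    Nat.pow_lt_pow_right (by norm_num) (by have := j.2; have : (i : ℕ) < j := hij; omega)
  generalize ∑ p ∈ (Finset.univ.erase i).erase j, (if d p = true then 2 ^ (n - (p : ℕ)) else 0) = S
  generalize 2 ^ (n - (i : ℕ)) = A at *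
  generalize 2 ^ (n - (j : ℕ)) = B at *
  simp only [if_true, Bool.false_eq_true, if_false]
  split_ifs <;> omega

theorem exists_NF_aux (hx : SA Q x) {t : F} (ht : t ∉ asP F) (N : ℕ) : ∀ (a b : ℕ)
    (l r : Fin n → ℕ) (d : Fin n → Bool) (e f : Fin n → V), GF Q x t l r d e f →
    ∑ i, (l i + r i) = N → Antitone (fun i => l i + r i) → N - ∑ i, l i = a → Dw d = b →
    ∃ (l r : Fin n → ℕ) (d : Fin n → Bool) (e f : Fin n → V), GF Q x t l r d e f ∧
      ∑ i, (l i + r i) = N ∧ NF l r d := by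
  intro a
  induction a using Nat.strong_induction_on with
  | _ a ih1 =>
  intro b
  induction b using Nat.strong_induction_on with
  | _ b ih2 =>
  intro l r d e f h hs hm ha hb
  have step : (∃ (l' r' : Fin n → ℕ) (d' : Fin n → Bool) (e' f' : Fin n → V),
      GF Q x t l' r' d' e' f' ∧ (∀ p, l' p + r' p = l p + r p) ∧ ∑ p, l p < ∑ p, l' p) →
      ∃ (l r : Fin n → ℕ) (d : Fin n → Bool) (e f : Fin n → V), GF Q x t l r d e f ∧
      ∑ i, (l i + r i) = N ∧ NF l r d := by
    rintro ⟨l', r', d', e', f', h1, h2, h3⟩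
    have h4 : ∑ i, (l' i + r' i) = N := by simp only [h2]; exact hs
    have h5 : ∑ p, l' p ≤ N := by rw [← h4, Finset.sum_add_distrib]; omega
    exact ih1 (N - ∑ i, l' i) (by omega) _ l' r' d' e' f' h1 h4 (by simpa only [h2] using hm) rfl rfl
  by_cases c1 : ∃ i j, i < j ∧ l i < l j
  · obtain ⟨i, j, hij, hl⟩ := c1
    exact step (h.red1 hx ht hij.ne (hm hij.le) hl)
  by_cases c2 : ∃ i j, i < j ∧ r i < r j
  · obtain ⟨i, j, hij, hl⟩ := c2
    exact step (h.red2 hx ht hij.ne (hm hij.le) hl)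
  push Not at c1 c2
  by_cases c3 : ∃ i j, i < j ∧ r i < l j ∧ d i = true
  · obtain ⟨i, j, hij, hl, hd⟩ := c3
    obtain ⟨l', r', d', e', f', h1, h2, h3, h4, h5⟩ := h.red3 hx ht hij.ne (hm hij.le) (c2 i j hij) hl hd
    by_cases heq : ∑ p, l p < ∑ p, l' p
    · exact step ⟨l', r', d', e', f', h1, h2, heq⟩
    · have h6 : ∑ p, l p ≤ ∑ p, l' p := Finset.sum_le_sum fun p _ => h3 p
      have h7 : ∑ p, l' p = ∑ p, l p := by omega
      refine ih2 (Dw d') (by rw [← hb]; exact Dw_lt hij hd h4 h5) l' r' d' e' f' h1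
        (by simp only [h2]; exact hs) (by simpa only [h2] using hm) (by rw [h7, ha]) rfl
  · push Not at c3
    refine ⟨l, r, d, e, f, h, hs, ?_, ?_, fun i => (h.nb i).le, fun i => (h.nb i).hd, ?_⟩
    · intro i j hij
      rcases hij.lt_or_eq with h1 | h1
      · exact c1 i j h1
      · rw [h1]
    · intro i j hij
      rcases hij.lt_or_eq with h1 | h1
      · exact c2 i j h1
      · rw [h1]
    · intro i j hij h1
      simpa using c3 i j hij h1

/-- Existence of normal forms. -/
theorem exists_NF [FiniteDimensional F V] (hx : SA Q x) (hnil : IsNilpotent x)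
    (hnd : ∀ v, (∀ w, polar Q v w = 0) → v = 0)
    (hdim : Module.finrank F V = 2 * n) {t : F} (ht : t ∉ asP F) :
    ∃ (l r : Fin n → ℕ) (d : Fin n → Bool) (e f : Fin n → V), GF Q x t l r d e f ∧
      ∑ i, (l i + r i) = n ∧ NF l r d := by
  obtain ⟨l, r, d, e, f, h1, h2, h3⟩ := exists_GF hx hnil hnd hdim ht
  exact exists_NF_aux hx ht n _ _ l r d e f h1 h2 h3 rfl rfl

end Red
end NilOrb

namespace NilOrb
set_option linter.unusedSectionVars false
section Uniq
variable {F : Type*} [Field F] [Fintype F] [CharP F 2]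
variable {V : Type*} [AddCommGroup V] [Module F V]
variable {Q : QuadraticForm F V} {x : Module.End F V} {n : ℕ}
variable {m : Fin n → ℕ} {e f : Fin n → V}
open QuadraticMap

theorem antitone_le {m m' : Fin n → ℕ} (hm : Antitone m)
    (h : ∀ k, ∑ i, (m i - k) = ∑ i, (m' i - k)) (i : Fin n) (ih : ∀ j, j < i → m j = m' j) :
    m' i ≤ m i := by
  by_contra hc
  have : ∑ j, (m j - m i) < ∑ j, (m' j - m i) := by
    refine Finset.sum_lt_sum (fun j _ => ?_) ⟨i, Finset.mem_univ _, by omega⟩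
    rcases lt_or_ge j i with hj | hj
    · rw [ih j hj]
    · have := hm hj
      omega
  rw [h] at this
  omega

theorem antitone_eq {m m' : Fin n → ℕ} (hm : Antitone m) (hm' : Antitone m')
    (h : ∀ k, ∑ i, (m i - k) = ∑ i, (m' i - k)) : m = m' := by
  funext i
  induction i using WellFoundedLT.induction with
  | ind i ih =>
    exact le_antisymm (antitone_le hm' (fun k => (h k).symm) i fun j hj => (ih j hj).symm)
      (antitone_le hm h i ih)

theorem PF.ker_coord (hx : SA Q x) (h : PF Q x m e f) {k : ℕ} {c b : J m → F}
    (hk : (x ^ k) (T x m e f (c, b)) = 0) (p : J m) (hp : p.2 + k < m p.1) :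
    c p = 0 ∧ b p = 0 := by
  have key : ∀ q : J m, (q.1 = p.1 ∧ (q.2 : ℕ) + (k + (m p.1 - 1 - k - p.2)) + 1 = m q.1) ↔
      q = p := by
    intro q
    constructor
    · rintro ⟨h1, h2⟩
      have h3 : m q.1 = m p.1 := by rw [h1]
      exact J.ext' h1 (by omega)
    · rintro rfl
      exact ⟨rfl, by omega⟩
  constructor
  · have h1 : polar Q ((x ^ k) (T x m e f (c, b))) ((x ^ (m p.1 - 1 - k - p.2)) (f p.1)) = 0 := by
      rw [hk]; simp
    rw [hx.pow_symm, pow_pow_apply, T_apply, polar_add_left, polar_sum_left, polar_sum_left] at h1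
    have h2 : ∀ q : J m, polar Q (E x m f q) ((x ^ (k + (m p.1 - 1 - k - p.2))) (f p.1)) = 0 := by
      intro q; rw [E, hx.move, h.ff' hx]
    have h3 : ∀ q : J m, polar Q (E x m e q) ((x ^ (k + (m p.1 - 1 - k - p.2))) (f p.1)) =
        if q = p then 1 else 0 := by
      intro q; rw [E, h.pair hx]; simp only [key]
    simpa only [h2, h3, mul_zero, mul_ite, mul_one, Finset.sum_const_zero,
        Finset.sum_ite_eq', Finset.mem_univ, if_true, zero_add, add_zero] using h1
  · have h1 : polar Q ((x ^ k) (T x m e f (c, b))) ((x ^ (m p.1 - 1 - k - p.2)) (e p.1)) = 0 := by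
      rw [hk]; simp
    rw [hx.pow_symm, pow_pow_apply, T_apply, polar_add_left, polar_sum_left, polar_sum_left] at h1
    have h2 : ∀ q : J m, polar Q (E x m e q) ((x ^ (k + (m p.1 - 1 - k - p.2))) (e p.1)) = 0 := by
      intro q; rw [E, hx.move, h.ee' hx]
    have h3 : ∀ q : J m, polar Q (E x m f q) ((x ^ (k + (m p.1 - 1 - k - p.2))) (e p.1)) =
        if q = p then 1 else 0 := by
      intro q; rw [E, h.pair' hx]; simp only [key]
    simpa only [h2, h3, mul_zero, mul_ite, mul_one, Finset.sum_const_zero,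
        Finset.sum_ite_eq', Finset.mem_univ, if_true, zero_add, add_zero] using h1

variable {t : F} {l r l' r' : Fin n → ℕ} {d d' : Fin n → Bool} {e' f' : Fin n → V}

theorem GF.l_bound (hx : SA Q x) (h : GF Q x t l r d e f) (hn : NF l r d)
    (hs : Function.Surjective (T x (fun i => l i + r i) e f)) (i : Fin n) {v : V}
    (hv : (x ^ (l i + r i)) v = 0) {a : ℕ} (ha : l i ≤ a) : Q ((x ^ a) v) = 0 := by
  obtain ⟨⟨c, b⟩, rfl⟩ := hs v
  have hz := fun p hp => h.pf.ker_coord hx hv p hp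
  have hlt : ∀ j, l i < l j → j < i := by
    intro j hj
    by_contra hc
    have := hn.al (not_lt.1 hc)
    omega
  have hri := hn.le i
  rw [h.pf.Q_T hx, Finset.sum_eq_zero, Finset.sum_eq_zero, Finset.sum_eq_zero]
  · simp
  · intro p _
    by_cases hp : p.2 + (l i + r i) < l p.1 + r p.1
    · rw [(hz p hp).1]; simp
    · rw [Finset.sum_eq_zero, mul_zero]
      intro q _
      rw [if_neg, mul_zero]
      rintro ⟨-, h2⟩
      omega
  · intro p _
    by_cases hp : p.2 + (l i + r i) < l p.1 + r p.1
    · rw [(hz p hp).2]; simp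
    · rw [(h.nb _).hf, if_neg, mul_zero]
      rintro ⟨h1, h2, -⟩
      have := hn.ar (hlt p.1 (by omega)).le
      omega
  · intro p _
    by_cases hp : p.2 + (l i + r i) < l p.1 + r p.1
    · rw [(hz p hp).1]; simp
    · rw [(h.nb _).he, if_neg, mul_zero]
      rintro ⟨h1, h2⟩
      have := hn.ar (hlt p.1 (by omega)).le
      omega

theorem GF.l_le (hx : SA Q x) (h : GF Q x t l r d e f) (hn : NF l r d)
    (hs : Function.Surjective (T x (fun i => l i + r i) e f))
    (h' : GF Q x t l' r' d' e' f') (i : Fin n) (hm : l i + r i = l' i + r' i) : l' i ≤ l i := by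
  by_contra hc
  have h1 := h.l_bound hx hn hs i (v := e' i) (by rw [hm]; exact (h'.pf.hb i).ze)
    (a := l' i - 1) (by omega)
  have := hn.le i
  rw [h'.qe (by omega)] at h1
  exact one_ne_zero h1

theorem GF.d_eq [Fintype V] (hx : SA Q x) (ht : t ∉ asP F) (h : GF Q x t l r d e f) (hn : NF l r d)
    (hs : Function.Bijective (T x (fun i => l i + r i) e f))
    (h' : GF Q x t l r d' e' f') (hn' : NF l r d')
    (hs' : Function.Bijective (T x (fun i => l i + r i) e' f')) : d = d' := by
  classical
  funext i
  induction i using WellFoundedLT.induction with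
  | ind i ih =>
  by_contra hne
  have hlt : r i < l i := by
    rcases (hn.le i).lt_or_eq with h1 | h1
    · exact h1
    · exact absurd ((hn.hd i h1).trans (hn'.hd i h1).symm) hne
  have hgt : ∀ j, i < j → l j ≤ r i := by
    intro j hj
    by_contra hc
    exact hne ((hn.hij i j hj (not_le.1 hc)).trans (hn'.hij i j hj (not_le.1 hc)).symm)
  have hk : ∀ j, r i < l j → r i ≤ r j := by
    intro j hj
    rcases lt_or_ge i j with h1 | h1
    · have := hgt j h1; omega
    · exact hn.ar h1
  obtain ⟨N, hN, h1⟩ := h.gauss hx hs (r i) hk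
  obtain ⟨N', hN', h2⟩ := h'.gauss hx hs' (r i) hk
  set S := ∑ j, if r i ≤ r j ∧ d j = true then t else 0 with hS
  set S' := ∑ j, if r i ≤ r j ∧ d' j = true then t else 0 with hS'
  have h3 : S + S' = t := by
    rw [hS, hS', ← Finset.sum_add_distrib, Finset.sum_eq_single i]
    · rcases hd : d i <;> rcases hd' : d' i
      · exact absurd (hd.trans hd'.symm) hne
      · simp
      · simp
      · exact absurd (hd.trans hd'.symm) hne
    · intro j _ hj
      rcases lt_or_gt_of_ne hj with h4 | h4
      · rw [ih j h4, CharTwo.add_self_eq_zero]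
      · have h5 := hgt j h4
        have hz : ∀ d : Fin n → Bool, NF l r d → ¬ (r i ≤ r j ∧ d j = true) := by
          rintro d hd ⟨h6, h7⟩
          have h8 := hd.le j
          have := hd.hd j (by omega)
          rw [this] at h7
          simp at h7
        rw [if_neg (hz d hn), if_neg (hz d' hn'), add_zero]
    · simp
  have h4 : psi (S + S') = -1 := by rw [h3]; exact psi_ne ht
  rw [psi_add] at h4
  have hN1 : (0 : ℤ) < N := by exact_mod_cast hN
  have hN2 : (0 : ℤ) < N' := by exact_mod_cast hN'
  rw [h1] at h2
  rcases psi_eq_or S with a1 | a1 <;> rcases psi_eq_or S' with a2 | a2 <;>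
    rw [a1, a2] at h2 h4 <;> omega

theorem NF.anti_m (hn : NF l r d) : Antitone (fun i => l i + r i) :=
  fun _ _ hij => Nat.add_le_add (hn.al hij) (hn.ar hij)

/-- Uniqueness of normal forms. -/
theorem GF.unique [Fintype V] (hx : SA Q x) (ht : t ∉ asP F)
    (h : GF Q x t l r d e f) (hn : NF l r d)
    (hs : Function.Bijective (T x (fun i => l i + r i) e f))
    (h' : GF Q x t l' r' d' e' f') (hn' : NF l' r' d')
    (hs' : Function.Bijective (T x (fun i => l' i + r' i) e' f')) :
    l = l' ∧ r = r' ∧ d = d' := by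
  have hm : (fun i => l i + r i) = (fun i => l' i + r' i) := by
    refine antitone_eq hn.anti_m hn'.anti_m fun k => ?_
    have h1 := h.pf.finrank_range_pow hx hs.2 k
    have h2 := h'.pf.finrank_range_pow hx hs'.2 k
    omega
  have hm' : ∀ i, l i + r i = l' i + r' i := fun i => congrFun hm i
  have hl : l = l' := by
    funext i
    exact le_antisymm (h'.l_le hx hn' hs'.2 h i (hm' i).symm) (h.l_le hx hn hs.2 h' i (hm' i))
  subst hl
  have hr : r = r' := by
    funext i
    have := hm' i
    omega
  subst hr
  exact ⟨rfl, rfl, h.d_eq hx ht hn hs h' hn' hs'⟩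

end Uniq
end NilOrb

namespace NilOrb
set_option linter.unusedSectionVars false
section Model
variable {F : Type*} [Field F] [Fintype F] [CharP F 2] {n : ℕ}
open QuadraticMap

/-- Shift of a finite sequence. -/
def shf {k : ℕ} (c : Fin k → F) (a : Fin k) : F :=
  if h : 0 < (a : ℕ) then c ⟨a - 1, by omega⟩ else 0

theorem shf_sum {k : ℕ} (c b : Fin k → F) :
    ∑ a, shf c a * b a.rev = ∑ a, c a * shf b a.rev := by
  cases k with
  | zero => simp
  | succ k =>
    rw [Fin.sum_univ_succ, Fin.sum_univ_castSucc]
    have h1 : shf c 0 = 0 := by simp [shf]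
    have h2 : shf b (Fin.last k).rev = 0 := by simp [shf]
    rw [h1, h2, zero_mul, mul_zero, zero_add, add_zero]
    refine Finset.sum_congr rfl fun a _ => ?_
    have h3 : shf c a.succ = c a.castSucc := by
      simp [shf]; rfl
    have h4 : shf b (a.castSucc).rev = b (a.succ).rev := by
      rw [shf, dif_pos (by simp [Fin.val_rev])]
      congr 1
    rw [h3, h4]

variable {m : Fin n → ℕ}

/-- The shift on functions on `J m`. -/
def sh (m : Fin n → ℕ) : (J m → F) →ₗ[F] (J m → F) where
  toFun c p := shf (fun a => c ⟨p.1, a⟩) p.2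
  map_add' c b := by
    funext p
    simp only [shf, Pi.add_apply]
    split_ifs <;> simp
  map_smul' y c := by
    funext p
    simp only [shf, Pi.smul_apply, RingHom.id_apply]
    split_ifs <;> simp

/-- The shift operator of the model. -/
def x0 (F : Type*) [Field F] (m : Fin n → ℕ) : Module.End F ((J m → F) × (J m → F)) :=
  LinearMap.prodMap (sh m) (sh m)

/-- The bilinear form of the model. -/
def B0 (sE sF : J m → F) :
    LinearMap.BilinMap F ((J m → F) × (J m → F)) F :=
  LinearMap.mk₂ F (fun u v => ∑ p, (sE p * u.1 p * v.1 p + sF p * u.2 p * v.2 p +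
      u.1 p * v.2 (J.rev p)))
    (by
      intro u u' v
      rw [← Finset.sum_add_distrib]
      refine Finset.sum_congr rfl fun p _ => ?_
      simp; ring)
    (by
      intro y u v
      rw [smul_eq_mul, Finset.mul_sum]
      refine Finset.sum_congr rfl fun p _ => ?_
      simp; ring)
    (by
      intro u v v'
      rw [← Finset.sum_add_distrib]
      refine Finset.sum_congr rfl fun p _ => ?_
      simp; ring)
    (by
      intro y u v
      rw [smul_eq_mul, Finset.mul_sum]
      refine Finset.sum_congr rfl fun p _ => ?_
      simp; ring)

/-- The quadratic form of the model. -/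
def Q0 (sE sF : J m → F) : QuadraticForm F ((J m → F) × (J m → F)) :=
  (B0 sE sF).toQuadraticMap

theorem Q0_apply (sE sF : J m → F) (u : (J m → F) × (J m → F)) :
    Q0 sE sF u = ∑ p, (sE p * u.1 p * u.1 p + sF p * u.2 p * u.2 p + u.1 p * u.2 (J.rev p)) := by
  simp [Q0, B0, LinearMap.BilinMap.toQuadraticMap_apply]

theorem Q0_polar (sE sF : J m → F) (u v : (J m → F) × (J m → F)) :
    polar (Q0 sE sF) u v = ∑ p, (u.1 p * v.2 (J.rev p) + v.1 p * u.2 (J.rev p)) := by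
  rw [Q0, LinearMap.BilinMap.polar_toQuadraticMap]
  simp only [B0, LinearMap.mk₂_apply]
  rw [← Finset.sum_add_distrib]
  refine Finset.sum_congr rfl fun p _ => ?_
  have h1 := CharTwo.add_self_eq_zero (sE p * u.1 p * v.1 p)
  have h2 := CharTwo.add_self_eq_zero (sF p * u.2 p * v.2 p)
  linear_combination h1 + h2

theorem Q0_SA (sE sF : J m → F) : SA (Q0 sE sF) (x0 F m) := by
  intro v
  rw [Q0_polar, Finset.sum_add_distrib]
  have : ∑ p, (x0 F m v).1 p * v.2 (J.rev p) = ∑ p, v.1 p * (x0 F m v).2 (J.rev p) := by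
    rw [Fintype.sum_sigma, Fintype.sum_sigma]
    refine Finset.sum_congr rfl fun i _ => ?_
    exact shf_sum (fun a => v.1 ⟨i, a⟩) (fun a => v.2 ⟨i, a⟩)
  rw [this, CharTwo.add_self_eq_zero]

/-- Basis functions. -/
def bv (F : Type*) [Field F] (m : Fin n → ℕ) (i : Fin n) (a : ℕ) : J m → F :=
  fun p => if p.1 = i ∧ (p.2 : ℕ) = a then 1 else 0

theorem sh_bv (i : Fin n) (a : ℕ) : sh m (bv F m i a) = bv F m i (a + 1) := by
  funext p
  simp only [sh, LinearMap.coe_mk, AddHom.coe_mk, shf, bv]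
  split_ifs with h1 h2 h3 h3 h4
  · rfl
  · exact absurd ⟨h2.1, by have := h2.2; omega⟩ h3
  · exact absurd ⟨h3.1, by have := h3.2; omega⟩ h2
  · rfl
  · have := h4.2; omega
  · rfl

theorem bv_zero {i : Fin n} {a : ℕ} (h : m i ≤ a) : bv F m i a = 0 := by
  funext p
  rw [bv, if_neg]
  · rfl
  · rintro ⟨rfl, h2⟩
    have := p.2.2
    omega

theorem x0_pow_e (i : Fin n) (a b : ℕ) : ((x0 F m) ^ a) (bv F m i b, 0) = (bv F m i (a + b), 0) := by
  induction a with
  | zero => simp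
  | succ a ih =>
    rw [pow_succ', Module.End.mul_apply, ih, x0, LinearMap.prodMap_apply, sh_bv, map_zero,
      show a + b + 1 = a + 1 + b by ring]

theorem x0_pow_f (i : Fin n) (a b : ℕ) : ((x0 F m) ^ a) (0, bv F m i b) = (0, bv F m i (a + b)) := by
  induction a with
  | zero => simp
  | succ a ih =>
    rw [pow_succ', Module.End.mul_apply, ih, x0, LinearMap.prodMap_apply, sh_bv, map_zero,
      show a + b + 1 = a + 1 + b by ring]

theorem sum_bv (g : J m → F) (i : Fin n) {a : ℕ} (ha : a < m i) :
    ∑ p, g p * bv F m i a p = g ⟨i, ⟨a, ha⟩⟩ := by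
  rw [Finset.sum_eq_single (⟨i, ⟨a, ha⟩⟩ : J m)]
  · simp [bv]
  · intro p _ hp
    rw [bv, if_neg, mul_zero]
    rintro ⟨h1, h2⟩
    exact hp (J.ext' h1 h2)
  · simp

theorem bv_rev (i : Fin n) {a : ℕ} (ha : a < m i) (p : J m) :
    bv F m i a (J.rev p) = bv F m i (m i - 1 - a) p := by
  have h1 := p.2.2
  simp only [bv, J.rev_snd, J.rev_fst]
  by_cases hp : p.1 = i
  · have h2 : m p.1 = m i := by rw [hp]
    have h3 : m p.1 - 1 - p.2 = a ↔ (p.2 : ℕ) = m i - 1 - a := by omega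
    simp only [h3]
  · simp [hp]

theorem bv_apply_mk (i j : Fin n) {a : ℕ} (ha : a < m i) (b : ℕ) :
    bv F m j b ⟨i, ⟨a, ha⟩⟩ = if i = j ∧ a = b then 1 else 0 := rfl

theorem model_GF {t : F} {l r : Fin n → ℕ} {d : Fin n → Bool} (hle : ∀ i, r i ≤ l i)
    (hd : ∀ i, r i = l i → d i = false) :
    ∃ Q : QuadraticForm F ((J (fun i => l i + r i) → F) × (J (fun i => l i + r i) → F)),
      SA Q (x0 F (fun i => l i + r i)) ∧
      (∀ v, (∀ w, polar Q v w = 0) → v = 0) ∧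
      GF Q (x0 F (fun i => l i + r i)) t l r d (fun i => (bv F _ i 0, 0))
        (fun i => (0, bv F _ i 0)) := by
  set m : Fin n → ℕ := fun i => l i + r i with hm
  let sE : J m → F := fun p => if (p.2 : ℕ) + 1 = l p.1 ∧ r p.1 < l p.1 then 1 else 0
  let sF : J m → F := fun p => if (p.2 : ℕ) = r p.1 ∧ r p.1 < l p.1 ∧ d p.1 = true then t else 0
  have hx := Q0_SA sE sF
  have hpef : ∀ (v : (J m → F) × (J m → F)) i a (ha : a < m i),
      polar (Q0 sE sF) v (0, bv F m i a) = v.1 ⟨i, ⟨m i - 1 - a, by omega⟩⟩ := by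
    intro v i a ha
    rw [Q0_polar]
    simp only [bv_rev i ha, Pi.zero_apply, zero_mul, add_zero]
    rw [sum_bv]
  refine ⟨Q0 sE sF, hx, ?_, ?_, ?_⟩
  · intro v hv
    refine Prod.ext (funext fun p => ?_) (funext fun p => ?_)
    · have h1 := hv (0, bv F m p.1 (m p.1 - 1 - p.2))
      have h2 := p.2.2
      rw [hpef _ _ _ (by omega)] at h1
      have h3 : (⟨p.1, ⟨m p.1 - 1 - (m p.1 - 1 - p.2), by omega⟩⟩ : J m) = p :=
        J.ext' rfl (by dsimp only; omega)
      rwa [h3] at h1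
    · have h1 := hv (bv F m p.1 (m p.1 - 1 - p.2), 0)
      have h2 := p.2.2
      rw [polar_comm, Q0_polar] at h1
      simp only [Pi.zero_apply, zero_mul, mul_zero, add_zero] at h1
      have h3 : ∀ q : J m, bv F m p.1 (m p.1 - 1 - p.2) q * v.2 (J.rev q) =
          v.2 (J.rev q) * bv F m p.1 (m p.1 - 1 - p.2) q := fun q => mul_comm _ _
      simp only [h3] at h1
      rw [sum_bv _ _ (by omega)] at h1
      have h4 : J.rev (⟨p.1, ⟨m p.1 - 1 - p.2, by omega⟩⟩ : J m) = p :=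
        J.ext' rfl (by rw [J.rev_snd]; dsimp only; omega)
      rwa [h4] at h1
  · refine ⟨fun i => ⟨fun a => ?_, ?_, ?_⟩, fun i j hij a => ?_, fun i j hij a => ?_,
      fun i j hij a => ?_⟩
    · rw [x0_pow_e]
      by_cases h0 : 0 < m i
      · rw [hpef _ _ _ h0]; dsimp only; rw [bv_apply_mk]
        have : (m i - 1 - 0 = a + 0) ↔ (a + 1 = m i) := by omega
        simp only [true_and, this]; rfl
      · rw [bv_zero (by omega), if_neg (show ¬ a + 1 = l i + r i by simp only [hm] at h0; omega)]
        exact polar_zero_left _ _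
    · rw [x0_pow_e, bv_zero (by simp [hm])]; rfl
    · rw [x0_pow_f, bv_zero (by simp [hm])]; rfl
    · rw [x0_pow_e, Q0_polar]; simp
    · rw [x0_pow_f, Q0_polar]; simp
    · rw [x0_pow_e]
      by_cases h0 : 0 < m j
      · rw [hpef _ _ _ h0]; dsimp only; rw [bv_apply_mk, if_neg (fun hh => hij hh.1.symm)]
      · rw [bv_zero (i := j) (by omega)]
        exact polar_zero_right _ _
  · intro i
    refine ⟨hle i, hd i, fun a => ?_, fun a => ?_⟩
    · rw [x0_pow_e, Q0_apply]
      simp only [Pi.zero_apply, mul_zero, add_zero]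
      by_cases ha : a < m i
      · rw [sum_bv _ _ ha, bv_apply_mk]; simp [sE]
      · rw [bv_zero (by omega), if_neg (show ¬ _ by simp only [hm] at ha; have := hle i; omega)]; simp
    · rw [x0_pow_f, Q0_apply]
      simp only [Pi.zero_apply, mul_zero, zero_mul, add_zero, zero_add]
      by_cases ha : a < m i
      · rw [sum_bv _ _ ha, bv_apply_mk]; simp [sF]
      · rw [bv_zero (by omega), if_neg (show ¬ _ by simp only [hm] at ha; have := hle i; omega)]; simp

end Model
end NilOrb

namespace NilOrb
set_option linter.unusedSectionVars false
section VFacts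
variable {F : Type*} [Field F] [Fintype F] [CharP F 2] {V : Type*} [AddCommGroup V] [Module F V]
  {Q : QuadraticForm F V} {x : Module.End F V} {n : ℕ}
open QuadraticMap

theorem polar_W {W : Submodule F V} (hW : ∀ w ∈ W, Q w = 0) {v w : V} (hv : v ∈ W) (hw : w ∈ W) :
    polar Q v w = 0 := by
  rw [polar, hW _ (W.add_mem hv hw), hW _ hv, hW _ hw]; simp

theorem space_facts [FiniteDimensional F V] (hdim : Module.finrank F V = 2 * n)
    (hQ : Q.IsNondegenerateFormSpace) {W : Submodule F V} (hWd : Module.finrank F W = n)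
    (hW : ∀ w ∈ W, Q w = 0) :
    (∀ v, (∀ w, polar Q v w = 0) → v = 0) ∧ ∀ v, (∀ w ∈ W, polar Q v w = 0) → v ∈ W := by
  have hR : ∀ v, (∀ w, polar Q v w = 0) → Q v = 0 → v = 0 := by
    intro v hv h0
    by_contra hne
    refine hQ.2.2 v ?_ hne h0
    rw [QuadraticForm.polarRadical, LinearMap.mem_ker]
    ext w
    simp [hv w]
  let B : LinearMap.BilinForm F V := QuadraticMap.polarBilin Q
  have hB : B.IsRefl := by
    intro v w h
    change polar Q w v = 0
    rw [polar_comm]; exact h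
  have h1 := LinearMap.BilinForm.finrank_add_finrank_orthogonal hB W
  have h2 : W ⊓ B.orthogonal ⊤ = ⊥ := by
    rw [eq_bot_iff]
    rintro v ⟨hv, hv2⟩
    refine hR v (fun w => ?_) (hW v hv)
    rw [polar_comm]
    exact hv2 w trivial
  have h3 : W ≤ B.orthogonal W := fun v hv w hw => polar_W hW hw hv
  rw [h2, finrank_bot, hdim, hWd] at h1
  have h4 : W = B.orthogonal W := Submodule.eq_of_le_of_finrank_eq h3 (by omega)
  have h5 : ∀ v, (∀ w ∈ W, polar Q v w = 0) → v ∈ W := by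
    intro v hv
    rw [h4]
    intro w hw
    change polar Q w v = 0
    rw [polar_comm]; exact hv w hw
  exact ⟨fun v hv => hR v hv (hW v (h5 v fun w _ => hv w)), h5⟩

open Classical in
theorem gauss_pos [Fintype V] {W : Submodule F V}
    (hW : ∀ w ∈ W, Q w = 0) (hWW : ∀ v, (∀ w ∈ W, polar Q v w = 0) → v ∈ W) :
    0 < ∑ v, psi (Q v) := by
  have h1 : ∀ w : W, ∑ v, psi (Q v) = ∑ v, psi (Q v) * psi (polar Q v w) := by
    intro w
    rw [← Equiv.sum_comp (Equiv.addRight (w : V))]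
    refine Finset.sum_congr rfl fun v _ => ?_
    rw [Equiv.coe_addRight, QuadraticMap.map_add Q, hW _ w.2, add_zero, psi_add]
  have h2 : ∀ v, 0 ≤ psi (Q v) * ∑ w : W, psi (polar Q v w) := by
    intro v
    by_cases hv : v ∈ W
    · rw [hW v hv, psi_zero, one_mul]
      refine Finset.sum_nonneg fun w _ => ?_
      rw [polar_W hW hv w.2, psi_zero]; norm_num
    · have : ∑ w : W, psi (polar Q v w) = 0 := by
        obtain ⟨w, hw, hne⟩ : ∃ w ∈ W, polar Q v w ≠ 0 := by
          by_contra hcon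
          push Not at hcon
          exact hv (hWW v hcon)
        obtain ⟨y, hy⟩ : ∃ y : F, psi (y * polar Q v w) ≠ 1 := by
          by_contra hcon
          push Not at hcon
          exact hne (eq_zero_of_psi_line hcon)
        have hy' := (psi_eq_or _).resolve_left hy
        have h3 : ∑ u : W, psi (polar Q v u) = ∑ u : W, psi (polar Q v u) * -1 := by
          rw [← Equiv.sum_comp (Equiv.addRight (⟨y • w, W.smul_mem y hw⟩ : W))]
          refine Finset.sum_congr rfl fun u _ => ?_
          rw [Equiv.coe_addRight, Submodule.coe_add, polar_add_right, psi_add, polar_smul_right,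
            smul_eq_mul, hy']
        rw [← Finset.sum_mul] at h3
        linarith
      rw [this, mul_zero]
  have h3 : 0 < psi (Q 0) * ∑ w : W, psi (polar Q 0 w) := by
    simp [psi_zero, Fintype.card_pos]
  have h4 : (Fintype.card W : ℤ) * ∑ v, psi (Q v) = ∑ v, psi (Q v) * ∑ w : W, psi (polar Q v w) := by
    simp only [Finset.mul_sum]
    rw [Finset.sum_comm]
    rw [← Finset.mul_sum, Finset.sum_congr rfl (fun w _ => (h1 w).symm)]
    simp
  have h5 : 0 < (Fintype.card W : ℤ) * ∑ v, psi (Q v) := by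
    rw [h4]
    exact Finset.sum_pos' (fun v _ => h2 v) ⟨0, Finset.mem_univ _, h3⟩
  exact pos_of_mul_pos_right h5 (by positivity)

theorem std_GF [Fintype V] [FiniteDimensional F V] (hdim : Module.finrank F V = 2 * n)
    (hnd : ∀ v, (∀ w, polar Q v w = 0) → v = 0) (hpos : 0 < ∑ v, psi (Q v))
    {t : F} (ht : t ∉ asP F) :
    ∃ e f : Fin n → V, GF Q 0 t (fun _ => 1) (fun _ => 0) (fun _ => false) e f := by
  have hx : SA Q (0 : Module.End F V) := fun v => by simp
  obtain ⟨l, r, d, e, f, h, hs, hn⟩ := exists_NF hx (IsNilpotent.zero) hnd hdim ht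
  have hb := h.pf.T_bij hx (by rw [hdim, hs])
  have h1 := h.pf.finrank_range_pow hx hb.2 1
  have h2 : ∀ i, l i + r i = 1 := by
    have h3 : ∑ i, (l i + r i - 1) = 0 := by
      rw [pow_one, LinearMap.range_zero, finrank_bot] at h1
      omega
    rw [Finset.sum_eq_zero_iff] at h3
    have h4 : ∑ i, (l i + r i) = ∑ i : Fin n, 1 := by rw [hs]; simp
    have h5 := (Finset.sum_eq_sum_iff_of_le (fun i _ => ?_)).1 h4
    · exact fun i => h5 i (Finset.mem_univ _)
    · have := h3 i (Finset.mem_univ _); omega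
  have hl : l = fun _ => 1 := by
    funext i; have := h2 i; have := hn.le i; omega
  have hr : r = fun _ => 0 := by
    funext i; have := h2 i; have := hn.le i; omega
  have hd : d = fun _ => false := by
    funext i
    by_contra hi
    have hi' : d i = true := by simpa using hi
    obtain ⟨N, hN, hg⟩ := h.gauss hx hb 0 (fun j _ => Nat.zero_le _)
    have h6 : ∑ j, (if 0 ≤ r j ∧ d j = true then t else 0) = t := by
      rw [Finset.sum_eq_single i]
      · simp [hi']
      · intro j _ hji
        rw [if_neg]
        rintro ⟨_, hj⟩
        rcases lt_or_gt_of_ne hji with hlt | hlt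
        · have := hn.hij _ _ hlt (by simp [hl, hr]); simp_all
        · have := hn.hij _ _ hlt (by simp [hl, hr]); simp_all
      · simp
    rw [h6, psi_ne ht] at hg
    simp only [pow_zero, Module.End.one_apply] at hg
    rw [hg] at hpos
    have : (0 : ℤ) < N := by exact_mod_cast hN
    linarith
  subst hl hr hd
  exact ⟨e, f, h⟩

theorem std_iso {V' : Type*} [AddCommGroup V'] [Module F V'] {Q' : QuadraticForm F V'}
    [Fintype V] [FiniteDimensional F V] [Fintype V'] [FiniteDimensional F V']
    (hdim : Module.finrank F V = 2 * n) (hdim' : Module.finrank F V' = 2 * n)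
    (hnd : ∀ v, (∀ w, polar Q v w = 0) → v = 0) (hpos : 0 < ∑ v, psi (Q v))
    (hnd' : ∀ v, (∀ w, polar Q' v w = 0) → v = 0) (hpos' : 0 < ∑ v, psi (Q' v)) :
    ∃ g : V ≃ₗ[F] V', ∀ v, Q' (g v) = Q v := by
  obtain ⟨t, ht⟩ := exists_notMem_asP F
  obtain ⟨e, f, h⟩ := std_GF hdim hnd hpos ht
  obtain ⟨e', f', h'⟩ := std_GF hdim' hnd' hpos' ht
  have hx : SA Q (0 : Module.End F V) := fun v => by simp
  have hx' : SA Q' (0 : Module.End F V') := fun v => by simp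
  obtain ⟨g, hg, _⟩ := h.iso hx hx' h' (h.pf.T_bij hx (by simp [hdim])) (h'.pf.T_bij hx' (by simp [hdim']))
  exact ⟨g, hg⟩

theorem psi_par {t : F} (ht : t ∉ asP F) (d : Fin n → Bool) :
    psi (∑ j, if d j = true then t else 0) = (-1) ^ (Finset.univ.filter fun j => d j = true).card := by
  rw [psi_sum]
  have : ∀ j, psi (if d j = true then t else 0) = if d j = true then -1 else 1 := by
    intro j; split_ifs; exacts [psi_ne ht, psi_zero]
  simp only [this]
  rw [Finset.prod_ite]; simp

theorem GF.pos_iff [Fintype V] {t : F} {l r : Fin n → ℕ} {d : Fin n → Bool} {e f : Fin n → V}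
    (ht : t ∉ asP F)
    (hx : SA Q x) (h : GF Q x t l r d e f)
    (hb : Function.Bijective (T x (fun i => l i + r i) e f)) :
    0 < ∑ v, psi (Q v) ↔ Even (Finset.univ.filter fun j => d j = true).card := by
  obtain ⟨N, hN, hg⟩ := h.gauss hx hb 0 (fun j _ => Nat.zero_le _)
  simp only [pow_zero, Module.End.one_apply, Nat.zero_le, true_and] at hg
  rw [hg, psi_par ht]
  have : (0 : ℤ) < N := by exact_mod_cast hN
  rcases Nat.even_or_odd (Finset.univ.filter fun j => d j = true).card with h1 | h1
  · rw [h1.neg_one_pow]; simp [h1, hN]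
  · rw [h1.neg_one_pow]; simp [Nat.not_even_iff_odd.2 h1]

end VFacts
end NilOrb

namespace NilOrb
set_option linter.unusedSectionVars false
section Orbits
variable {F : Type*} [Field F] [Fintype F] [CharP F 2] {V : Type*} [AddCommGroup V] [Module F V]
  {Q : QuadraticForm F V} {x : Module.End F V} {n : ℕ}
open QuadraticMap

/-- Normal form data of total size `n` and even parity. -/
def NFT (n : ℕ) : Type := {p : (Fin n → ℕ) × (Fin n → ℕ) × (Fin n → Bool) //
  NF p.1 p.2.1 p.2.2 ∧ ∑ i, (p.1 i + p.2.1 i) = n ∧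
    Even (Finset.univ.filter fun j => p.2.2 j = true).card}

theorem PF.nilp {m : Fin n → ℕ} {e f : Fin n → V} (h : PF Q x m e f)
    (hs : Function.Surjective (T x m e f)) : IsNilpotent x := by
  refine ⟨∑ i, m i, ?_⟩
  have hle : ∀ i, m i ≤ ∑ i, m i := fun i =>
    Finset.single_le_sum (f := m) (fun _ _ => Nat.zero_le _) (Finset.mem_univ i)
  have key : ∀ (a : ℕ) (w : V), (x ^ (∑ i, m i)) w = 0 → (x ^ (∑ i, m i)) ((x ^ a) w) = 0 := by
    intro a w hw
    rw [← Module.End.mul_apply, ← pow_add, add_comm, pow_add, Module.End.mul_apply, hw, map_zero]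
  ext v
  obtain ⟨⟨c, b⟩, rfl⟩ := hs v
  rw [T_apply, map_add, map_sum (x ^ (∑ i, m i)), map_sum (x ^ (∑ i, m i))]
  rw [Finset.sum_eq_zero, Finset.sum_eq_zero]
  · simp
  · intro p _
    rw [map_smul, E, key, smul_zero]
    exact pow_zero_of_le (h.hb p.1).zf (hle _)
  · intro p _
    rw [map_smul, E, key, smul_zero]
    exact pow_zero_of_le (h.hb p.1).ze (hle _)

theorem SA.transport {V' : Type*} [AddCommGroup V'] [Module F V'] {Q' : QuadraticForm F V'}
    (hx : SA Q x) (g : V ≃ₗ[F] V') (hg : ∀ v, Q' (g v) = Q v) :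
    SA Q' (g.toLinearMap ∘ₗ x ∘ₗ g.symm.toLinearMap) := by
  intro v
  obtain ⟨w, rfl⟩ := g.surjective v
  have := hx w
  simp only [polar] at this ⊢
  simpa [← map_add, hg] using this

theorem card_orbits [FiniteDimensional F V] (hdim : Module.finrank F V = 2 * n)
    (hQ : Q.IsNondegenerateFormSpace) (hWitt : Q.HasTotallySingularSubspace n) :
    Q.numNilpotentOOrbits = Nat.card (NFT n) := by
  classical
  obtain ⟨W, hWd, hW⟩ := hWitt
  obtain ⟨hnd, hWW⟩ := space_facts hdim hQ hWd hW
  haveI : Finite V := Module.finite_of_finite F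
  letI : Fintype V := Fintype.ofFinite V
  have hpos := gauss_pos hW hWW
  obtain ⟨t, ht⟩ := exists_notMem_asP F
  let X := {x : Module.End F V // Q.mem_oLie x ∧ IsNilpotent x}
  have hbij : ∀ {x : Module.End F V} {l r : Fin n → ℕ} {d e f}, SA Q x → GF Q x t l r d e f →
      ∑ i, (l i + r i) = n → Function.Bijective (T x (fun i => l i + r i) e f) :=
    fun hx h hs => h.pf.T_bij hx (by rw [hdim, hs])
  have hex : ∀ y : X, ∃ p : NFT n, ∃ e f, GF Q y.1 t p.1.1 p.1.2.1 p.1.2.2 e f := by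
    intro y
    obtain ⟨l, r, d, e, f, h, hs, hn⟩ := exists_NF y.2.1.1 y.2.2 hnd hdim ht
    exact ⟨⟨(l, r, d), hn, hs, (h.pos_iff ht y.2.1.1 (hbij y.2.1.1 h hs)).1 hpos⟩, e, f, h⟩
  choose φ e f hφ using hex
  have huniq : ∀ (y : X) (p : NFT n) (e f), GF Q y.1 t p.1.1 p.1.2.1 p.1.2.2 e f → φ y = p := by
    intro y p e' f' h
    obtain ⟨h1, h2, h3⟩ := GF.unique y.2.1.1 ht (hφ y) (φ y).2.1 (hbij y.2.1.1 (hφ y) (φ y).2.2.1)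
      h p.2.1 (hbij y.2.1.1 h p.2.2.1)
    exact Subtype.ext (Prod.ext h1 (Prod.ext h2 h3))
  have hresp : ∀ y z : X, Q.OConj y.1 z.1 → φ y = φ z := by
    rintro y z ⟨g, hg, hgz⟩
    refine (huniq z (φ y) _ _ ((hφ y).map g hg ?_)).symm
    intro v
    rw [hgz]; simp
  unfold QuadraticForm.numNilpotentOOrbits
  refine Nat.card_congr (Equiv.ofBijective (Quot.lift φ hresp) ⟨?_, ?_⟩)
  · rintro ⟨y⟩ ⟨z⟩ hyz
    change φ y = φ z at hyz
    have hz := hφ z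
    rw [← hyz] at hz
    obtain ⟨g, hg, hgx⟩ := (hφ y).iso y.2.1.1 z.2.1.1 hz (hbij y.2.1.1 (hφ y) (φ y).2.2.1)
      (hbij z.2.1.1 hz (φ y).2.2.1)
    refine Quot.sound ⟨g, hg, ?_⟩
    ext v
    have := hgx (g.symm v)
    simp at this
    simp [this]
  · rintro ⟨⟨l, r, d⟩, hn, hs, hev⟩
    obtain ⟨Q', hx', hnd', h'⟩ := model_GF (F := F) (t := t) (d := d) hn.le hn.hd
    have hdim' : Module.finrank F
        ((J (fun i => l i + r i) → F) × (J (fun i => l i + r i) → F)) = 2 * n := by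
      rw [finrank_coord, hs]
    have hb' := h'.pf.T_bij hx' finrank_coord
    have hpos' := (h'.pos_iff ht hx' hb').2 hev
    obtain ⟨g, hg⟩ := std_iso hdim' hdim hnd' hpos' hnd hpos
    have hSA := hx'.transport g hg
    have h := h'.map (x' := g.toLinearMap ∘ₗ x0 F _ ∘ₗ g.symm.toLinearMap) g hg (fun v => by simp)
    have hnil := h.pf.nilp (hbij hSA h hs).2
    have htr := (LinearMap.isNilpotent_trace_of_isNilpotent hnil).eq_zero
    exact ⟨Quot.mk _ ⟨_, ⟨hSA, htr⟩, hnil⟩, huniq ⟨_, ⟨hSA, htr⟩, hnil⟩ ⟨(l, r, d), hn, hs, hev⟩ _ _ h⟩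

end Orbits
end NilOrb

namespace NilOrb
set_option linter.unusedSectionVars false
section Comb
variable {n : ℕ}

/-- Number of `true` values at or after `i`. -/
def cnt (d : Fin n → Bool) (i : Fin n) : ℕ := ∑ j, if i ≤ j ∧ d j = true then 1 else 0

theorem cnt_exists : ∀ (n : ℕ) (N P : Fin n → Prop), ∃ d : Fin n → Bool,
    (∀ i, ¬ N i → d i = false) ∧ ∀ i, N i → (Odd (cnt d i) ↔ P i) := by
  classical
  intro n
  induction n with
  | zero => intro N P; exact ⟨fun _ => false, fun i => i.elim0, fun i => i.elim0⟩
  | succ n ih =>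
    intro N P
    obtain ⟨d, h1, h2⟩ := ih (fun i => N i.succ) (fun i => P i.succ)
    let c := ∑ j, if d j = true then 1 else 0
    let b : Bool := if N 0 ∧ ¬ (Odd c ↔ P 0) then true else false
    refine ⟨Fin.cons b d, fun i => ?_, fun i => ?_⟩
    · refine Fin.cases ?_ (fun i => ?_) i
      · intro h; simp [b, h]
      · intro h; simpa using h1 i h
    · refine Fin.cases ?_ (fun i => ?_) i
      · intro h
        have : cnt (Fin.cons b d : Fin (n + 1) → Bool) 0 = (if b = true then 1 else 0) + c := by
          simp only [cnt, Fin.sum_univ_succ, c, Fin.cons_zero, Fin.cons_succ, Fin.zero_le, true_and]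
        rw [this]
        by_cases h3 : (Odd c ↔ P 0)
        · simp [b, h3]
        · have : b = true := by simp [b, h3, h]
          rw [this, if_pos rfl, add_comm, Nat.odd_add_one]
          tauto
      · intro h
        have : cnt (Fin.cons b d : Fin (n + 1) → Bool) i.succ = cnt d i := by
          rw [cnt, Fin.sum_univ_succ, if_neg (fun hh => absurd hh.1 (by simp)), zero_add]
          simp only [cnt, Fin.cons_succ, Fin.succ_le_succ_iff]
        rw [this]
        exact h2 i h

theorem cnt_eq {d : Fin n → Bool} {i j : Fin n} (hij : i ≤ j)
    (h : ∀ k, i ≤ k → k < j → d k = false) : cnt d i = cnt d j := by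
  refine Finset.sum_congr rfl fun k _ => ?_
  by_cases h1 : i ≤ k
  · by_cases h2 : j ≤ k
    · simp [h1, h2]
    · simp [h k h1 (not_le.1 h2)]
  · have : ¬ j ≤ k := fun h2 => h1 (hij.trans h2)
    simp [h1, this]

/-- Number of `true` values strictly after `i`. -/
def cnt' (d : Fin n → Bool) (i : Fin n) : ℕ := ∑ j, if i < j ∧ d j = true then 1 else 0

theorem cnt_cnt' (d : Fin n → Bool) (i : Fin n) :
    cnt d i = cnt' d i + if d i = true then 1 else 0 := by
  have : (if d i = true then 1 else 0) = ∑ j, if i = j then (if d j = true then 1 else 0) else 0 := by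
    simp
  rw [this, cnt, cnt', ← Finset.sum_add_distrib]
  refine Finset.sum_congr rfl fun j _ => ?_
  rcases lt_trichotomy i j with h | h | h
  · simp [h, h.le, h.ne]
  · subst h; simp
  · simp [h.not_ge, h.not_gt, h.ne']

theorem cnt'_eq {d : Fin n → Bool} {i j : Fin n} (hij : i < j)
    (h : ∀ k, i < k → k < j → d k = false) : cnt' d i = cnt d j := by
  refine Finset.sum_congr rfl fun k _ => ?_
  by_cases h1 : i < k
  · by_cases h2 : j ≤ k
    · simp [h1, h2]
    · simp [h k h1 (not_le.1 h2)]
  · have : ¬ j ≤ k := fun h2 => h1 (hij.trans_le h2)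
    simp [h1, this]

theorem total_eq {d : Fin n → Bool} {j : Fin n}
    (h : ∀ k, k < j → d k = false) :
    (Finset.univ.filter fun j => d j = true).card = cnt d j := by
  rw [Finset.card_filter]
  refine Finset.sum_congr rfl fun k _ => ?_
  by_cases h2 : j ≤ k
  · simp [h2]
  · simp [h k (not_le.1 h2)]

/-- First partition of the pair. -/
def fa (l r : Fin n → ℕ) (d : Fin n → Bool) (i : Fin n) : ℕ := if Odd (cnt d i) then r i else l i

theorem fa_anti {l r : Fin n → ℕ} {d : Fin n → Bool} (h : NF l r d) : Antitone (fa l r d) := by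
  intro i j hij
  have key : (∃ k, i ≤ k ∧ k < j ∧ d k = true) → fa l r d j ≤ fa l r d i := by
    rintro ⟨k, h1, h2, h3⟩
    have h4 : l j ≤ r k := by
      by_contra hc
      have := h.hij k j h2 (not_le.1 hc)
      simp_all
    have h5 := h.ar h1
    have h6 := h.le i
    have h7 := h.le j
    unfold fa
    split_ifs <;> omega
  by_cases hk : ∃ k, i ≤ k ∧ k < j ∧ d k = true
  · exact key hk
  · push Not at hk
    have := cnt_eq hij (fun k h1 h2 => by simpa using hk k h1 h2)
    unfold fa
    rw [this]
    have h1 := h.al hij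
    have h2 := h.ar hij
    split_ifs <;> omega

theorem fb_anti {l r : Fin n → ℕ} {d : Fin n → Bool} (h : NF l r d) : Antitone (fa r l d) := by
  intro i j hij
  have key : (∃ k, i ≤ k ∧ k < j ∧ d k = true) → fa r l d j ≤ fa r l d i := by
    rintro ⟨k, h1, h2, h3⟩
    have h4 : l j ≤ r k := by
      by_contra hc
      have := h.hij k j h2 (not_le.1 hc)
      simp_all
    have h5 := h.ar h1
    have h6 := h.le i
    have h7 := h.le j
    unfold fa
    split_ifs <;> omega
  by_cases hk : ∃ k, i ≤ k ∧ k < j ∧ d k = true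
  · exact key hk
  · push Not at hk
    have := cnt_eq hij (fun k h1 h2 => by simpa using hk k h1 h2)
    unfold fa
    rw [this]
    have h1 := h.al hij
    have h2 := h.ar hij
    split_ifs <;> omega

/-- Pairs of antitone sequences of total size `n`. -/
def PA (n : ℕ) : Set ((Fin n → ℕ) × (Fin n → ℕ)) :=
  {p | Antitone p.1 ∧ Antitone p.2 ∧ ∑ i, (p.1 i + p.2 i) = n}

/-- Pairs for which the first is lexicographically at least the second. -/
def PL (n : ℕ) : Set ((Fin n → ℕ) × (Fin n → ℕ)) :=
  {p | p ∈ PA n ∧ ∀ j, (∀ k, k < j → p.1 k = p.2 k) → p.2 j ≤ p.1 j}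

theorem fafb_sum (l r : Fin n → ℕ) (d : Fin n → Bool) (i : Fin n) :
    fa l r d i + fa r l d i = l i + r i := by
  unfold fa; split_ifs <;> omega

theorem PL_of_NF {l r : Fin n → ℕ} {d : Fin n → Bool} (h : NF l r d)
    (hs : ∑ i, (l i + r i) = n) (hev : Even (Finset.univ.filter fun j => d j = true).card) :
    (fa l r d, fa r l d) ∈ PL n := by
  refine ⟨⟨fa_anti h, fb_anti h, ?_⟩, ?_⟩
  · simp only [fafb_sum, hs]
  · intro j hj
    have h1 : ∀ k, k < j → d k = false := by
      intro k hk
      refine h.hd k ?_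
      have := hj k hk
      simp only [fa] at this
      split_ifs at this <;> omega
    rw [total_eq h1] at hev
    simp only [fa, if_neg (Nat.not_odd_iff_even.2 hev)]
    exact h.le j

theorem NF_inj {l r l' r' : Fin n → ℕ} {d d' : Fin n → Bool} (h : NF l r d) (h' : NF l' r' d')
    (ha : fa l r d = fa l' r' d') (hb : fa r l d = fa r' l' d') : l = l' ∧ r = r' ∧ d = d' := by
  have h1 : ∀ i, l i = l' i ∧ r i = r' i := by
    intro i
    have e1 := congrFun ha i
    have e2 := congrFun hb i
    have e3 := h.le i
    have e4 := h'.le i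
    simp only [fa] at e1 e2
    split_ifs at e1 e2 <;> omega
  obtain rfl : l = l' := funext fun i => (h1 i).1
  obtain rfl : r = r' := funext fun i => (h1 i).2
  refine ⟨rfl, rfl, ?_⟩
  funext i
  induction i using WellFoundedGT.induction with
  | ind i ih =>
    by_cases hi : r i = l i
    · rw [h.hd i hi, h'.hd i hi]
    · have h2 : cnt' d i = cnt' d' i := by
        refine Finset.sum_congr rfl fun j _ => ?_
        by_cases hj : i < j
        · rw [ih j hj]
        · simp [hj]
      have h3 : Odd (cnt d i) ↔ Odd (cnt d' i) := by
        have e1 := congrFun ha i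
        simp only [fa] at e1
        split_ifs at e1 <;> first | tauto | omega
      rw [cnt_cnt', cnt_cnt', h2] at h3
      cases hd : d i <;> cases hd' : d' i <;> simp [hd, hd', Nat.odd_add_one] at h3 ⊢ <;>
        rcases Nat.even_or_odd (cnt' d' i) with h4 | h4 <;>
        have h5 := Nat.not_even_iff_odd (n := cnt' d' i) <;> tauto

theorem NF_surj {p : (Fin n → ℕ) × (Fin n → ℕ)} (hp : p ∈ PL n) :
    ∃ l r d, NF l r d ∧ ∑ i, (l i + r i) = n ∧ Even (Finset.univ.filter fun j => d j = true).card ∧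
      fa l r d = p.1 ∧ fa r l d = p.2 := by
  obtain ⟨a, b⟩ := p
  obtain ⟨⟨haa, hab, hs⟩, hlex⟩ := hp
  dsimp only at haa hab hs hlex
  obtain ⟨d, hd1, hd2⟩ := cnt_exists n (fun i => a i ≠ b i) (fun i => a i < b i)
  have hal : Antitone (fun i => max (a i) (b i)) := fun i j hij => max_le_max (haa hij) (hab hij)
  have har : Antitone (fun i => min (a i) (b i)) := fun i j hij => min_le_min (haa hij) (hab hij)
  refine ⟨fun i => max (a i) (b i), fun i => min (a i) (b i), d,
    ⟨hal, har, fun i => min_le_max, fun i hi => hd1 i ?_, fun i j hij hlt => ?_⟩, ?_, ?_, ?_, ?_⟩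
  · omega
  · by_contra hdi
    have hdi' : d i = true := by simpa using hdi
    have hNi : a i ≠ b i := fun hh => hdi (hd1 i (by simpa using hh))
    have hNj : a j ≠ b j := by
      have := haa hij.le; have := hab hij.le; omega
    obtain ⟨j0, ⟨hj1, hj2⟩, hmin⟩ := WellFounded.has_min (wellFounded_lt (α := Fin n))
      {k | i < k ∧ a k ≠ b k} ⟨j, hij, hNj⟩
    have hjj : j0 ≤ j := not_lt.1 (hmin j ⟨hij, hNj⟩)
    have h1 : cnt d i = cnt d j0 + 1 := by
      rw [cnt_cnt', hdi', if_pos rfl, cnt'_eq hj1]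
      intro k hk1 hk2
      refine hd1 k fun hne => hmin k ⟨hk1, hne⟩ hk2
    have h2 := hd2 i hNi
    have h3 := hd2 j0 hj2
    rw [h1, Nat.odd_add_one, h3] at h2
    have := haa hj1.le
    have := hab hj1.le
    have := haa hjj
    have := hab hjj
    omega
  · refine Eq.trans ?_ hs
    refine Finset.sum_congr rfl fun i _ => ?_
    exact max_add_min _ _
  · by_cases hN : ∃ k, a k ≠ b k
    · obtain ⟨k, hk⟩ := hN
      obtain ⟨j0, hj2, hmin⟩ := WellFounded.has_min (wellFounded_lt (α := Fin n))
        {k | a k ≠ b k} ⟨k, hk⟩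
      have h0 : ∀ k, k < j0 → a k = b k := fun k hk => by
        by_contra hne; exact hmin k hne hk
      rw [total_eq (j := j0) (fun k hk => hd1 k (by simpa using h0 k hk)), ← Nat.not_odd_iff_even,
        hd2 j0 hj2]
      exact not_lt.2 (hlex j0 h0)
    · push Not at hN
      have : (Finset.univ.filter fun j => d j = true) = ∅ := by
        rw [Finset.filter_eq_empty_iff]
        intro k _
        rw [hd1 k (by simpa using hN k)]; simp
      rw [this]; simp
  · funext i
    by_cases hN : a i = b i
    · simp [fa, hN]
    · have := hd2 i hN
      simp only [fa, this]
      split_ifs <;> omega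
  · funext i
    by_cases hN : a i = b i
    · simp [fa, hN]
    · have := hd2 i hN
      simp only [fa, this]
      split_ifs <;> omega

theorem card_NFT (n : ℕ) : Nat.card (NFT n) = (PL n).ncard := by
  rw [← Nat.card_coe_set_eq]
  refine Nat.card_congr (Equiv.ofBijective
    (fun q : NFT n => (⟨(fa q.1.1 q.1.2.1 q.1.2.2, fa q.1.2.1 q.1.1 q.1.2.2),
      PL_of_NF q.2.1 q.2.2.1 q.2.2.2⟩ : PL n)) ⟨?_, ?_⟩)
  · intro q q' h
    have h1 := congrArg Subtype.val h
    obtain ⟨e1, e2, e3⟩ := NF_inj q.2.1 q'.2.1 (congrArg Prod.fst h1) (congrArg Prod.snd h1)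
    exact Subtype.ext (Prod.ext e1 (Prod.ext e2 e3))
  · rintro ⟨p, hp⟩
    obtain ⟨l, r, d, h1, h2, h3, h4, h5⟩ := NF_surj hp
    exact ⟨⟨(l, r, d), h1, h2, h3⟩, Subtype.ext (Prod.ext h4 h5)⟩

theorem PA_finite (n : ℕ) : (PA n).Finite := by
  refine ((Set.finite_Icc (0 : Fin n → ℕ) (fun _ => n)).prod
    (Set.finite_Icc (0 : Fin n → ℕ) (fun _ => n))).subset ?_
  rintro ⟨a, b⟩ ⟨_, _, hs⟩
  dsimp only at hs
  have h : ∀ i, a i + b i ≤ n := fun i => by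
    conv_rhs => rw [← hs]
    exact Finset.single_le_sum (f := fun i => a i + b i) (fun _ _ => Nat.zero_le _) (Finset.mem_univ i)
  refine ⟨⟨fun i => Nat.zero_le _, fun i => ?_⟩, ⟨fun i => Nat.zero_le _, fun i => ?_⟩⟩
  · have := h i; dsimp only; omega
  · have := h i; dsimp only; omega

/-- The diagonal pairs. -/
def PD (n : ℕ) : Set ((Fin n → ℕ) × (Fin n → ℕ)) := {p | p ∈ PA n ∧ p.1 = p.2}

theorem two_PL (n : ℕ) : 2 * (PL n).ncard = (PA n).ncard + (PD n).ncard := by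
  have hB : (Prod.swap '' PL n).ncard = (PL n).ncard :=
    Set.ncard_image_of_injective _ Prod.swap_injective
  have hfin : (PL n).Finite := (PA_finite n).subset fun p hp => hp.1
  have hsw : ∀ p, p ∈ Prod.swap '' PL n ↔ p.swap ∈ PL n := by
    intro p
    constructor
    · rintro ⟨q, hq, rfl⟩; simpa using hq
    · intro h; exact ⟨_, h, by simp⟩
  have hPA : ∀ p, p ∈ PA n → p.swap ∈ PA n := by
    rintro p ⟨h1, h2, h3⟩
    refine ⟨h2, h1, ?_⟩
    refine Eq.trans ?_ h3
    exact Finset.sum_congr rfl fun i _ => add_comm _ _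
  have hU : PL n ∪ Prod.swap '' PL n = PA n := by
    ext p
    rw [Set.mem_union, hsw]
    constructor
    · rintro (h | h)
      · exact h.1
      · simpa using hPA _ h.1
    · intro h
      by_cases hN : ∃ k, p.1 k ≠ p.2 k
      · obtain ⟨k, hk⟩ := hN
        obtain ⟨j0, hj2, hmin⟩ := WellFounded.has_min (wellFounded_lt (α := Fin n))
          {k | p.1 k ≠ p.2 k} ⟨k, hk⟩
        have h0 : ∀ j, (∀ k, k < j → p.1 k = p.2 k) → p.1 j = p.2 j ∨ j = j0 := by
          intro j hj
          by_contra hcon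
          push Not at hcon
          rcases lt_or_gt_of_ne hcon.2 with hlt | hlt
          · exact hmin j hcon.1 hlt
          · exact hj2 (hj j0 hlt)
        rcases le_total (p.2 j0) (p.1 j0) with hle | hle
        · refine Or.inl ⟨h, fun j hj => ?_⟩
          rcases h0 j hj with h1 | rfl
          · exact h1.ge
          · exact hle
        · refine Or.inr ⟨hPA p h, fun j hj => ?_⟩
          rcases h0 j (fun k hk => (hj k hk).symm) with h1 | rfl
          · exact h1.le
          · exact hle
      · push Not at hN
        exact Or.inl ⟨h, fun j _ => (hN j).ge⟩
  have hI : PL n ∩ Prod.swap '' PL n = PD n := by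
    ext p
    rw [Set.mem_inter_iff, hsw]
    constructor
    · rintro ⟨h1, h2⟩
      refine ⟨h1.1, funext fun j => ?_⟩
      induction j using WellFoundedLT.induction with
      | ind j ih => exact le_antisymm (h2.2 j fun k hk => (ih k hk).symm) (h1.2 j ih)
    · rintro ⟨h1, h2⟩
      exact ⟨⟨h1, fun j _ => by rw [h2]⟩, ⟨hPA p h1, fun j _ => by simp [h2]⟩⟩
  have := Set.ncard_union_add_ncard_inter (PL n) (Prod.swap '' PL n) hfin (hfin.image _)
  rw [hU, hI, hB] at this
  omega

end Comb
end NilOrb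

namespace NilOrb
set_option linter.unusedSectionVars false
section Count
variable {n : ℕ}

/-- Antitone sequences with sum `k`. -/
def AS (n k : ℕ) : Set (Fin n → ℕ) := {a | Antitone a ∧ ∑ i, a i = k}

/-- The partition of a sequence. -/
def toPart {k : ℕ} (a : AS n k) : Nat.Partition k :=
  Nat.Partition.ofSums k (Finset.univ.val.map a.1) a.2.2

theorem toPart_sum {k : ℕ} (a : AS n k) (c : ℕ) :
    ∑ i, (a.1 i - c) = ((toPart a).parts.map (fun y => y - c)).sum := by
  have h1 : ∀ s : Multiset ℕ, (s.map (fun y => y - c)).sum =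
      ((s.filter (· ≠ 0)).map (fun y => y - c)).sum := by
    intro s
    induction s using Multiset.induction_on with
    | empty => simp
    | cons y s ih =>
      by_cases hy : y = 0
      · subst hy
        rw [Multiset.map_cons, Multiset.sum_cons, ih, Multiset.filter_cons_of_neg _ (by simp)]
        simp
      · rw [Multiset.map_cons, Multiset.sum_cons, ih, Multiset.filter_cons_of_pos (p := fun y => y ≠ 0) _ hy,
          Multiset.map_cons, Multiset.sum_cons]
  have h2 : (toPart a).parts = (Finset.univ.val.map a.1).filter (· ≠ 0) := rfl
  rw [h2, ← h1, Multiset.map_map]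
  rfl

theorem toPart_bij {k : ℕ} (hk : k ≤ n) : Function.Bijective (toPart : AS n k → Nat.Partition k) := by
  constructor
  · intro a b h
    refine Subtype.ext (antitone_eq a.2.1 b.2.1 fun c => ?_)
    rw [toPart_sum, toPart_sum, h]
  · intro p
    have hcard : p.parts.card ≤ k := by
      have h1 := Multiset.card_nsmul_le_sum (s := p.parts) (a := 1) (fun y hy => p.parts_pos hy)
      rw [p.parts_sum] at h1
      simpa using h1
    let s' : Multiset ℕ := p.parts + Multiset.replicate (n - p.parts.card) 0
    have hs' : s'.card = n := by simp [s']; omega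
    obtain ⟨L, hL⟩ := Quot.exists_rep s'
    have hL' : (L : Multiset ℕ) = s' := hL
    have hlen : L.length = n := by rw [← hs', ← hL']; rfl
    subst hlen
    let f : Fin L.length → ℕ := L.get
    let g : Equiv.Perm (Fin L.length) := Fin.revPerm.trans (Tuple.sort f)
    have hanti : Antitone (f ∘ g) := by
      intro i j hij
      exact Tuple.monotone_sort f (Fin.rev_le_rev.2 hij)
    have hmap : Finset.univ.val.map (f ∘ g) = s' := by
      rw [← hL', ← Multiset.map_map]
      have : Multiset.map g Finset.univ.val = Finset.univ.val := by
        exact congrArg Finset.val (Finset.map_univ_equiv g)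
      rw [this, Fin.univ_val_map, List.ofFn_get]
    have hsum : ∑ i, (f ∘ g) i = k := by
      change (Finset.univ.val.map (f ∘ g)).sum = k
      rw [hmap]
      simp [s', p.parts_sum]
    refine ⟨⟨f ∘ g, hanti, hsum⟩, ?_⟩
    refine Nat.Partition.ext ?_
    change (Finset.univ.val.map (f ∘ g)).filter (· ≠ 0) = p.parts
    rw [hmap]
    simp only [s', Multiset.filter_add]
    rw [Multiset.filter_eq_self.2 (fun y hy => (p.parts_pos hy).ne'),
      Multiset.filter_eq_nil.2 (fun y hy => by rw [Multiset.eq_of_mem_replicate hy]; simp), add_zero]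

theorem card_AS {k : ℕ} (hk : k ≤ n) : Nat.card (AS n k) = numPartitions k := by
  rw [numPartitions, ← Nat.card_eq_fintype_card]
  exact Nat.card_congr (Equiv.ofBijective _ (toPart_bij hk))

theorem AS_finite {k : ℕ} (hk : k ≤ n) : Finite (AS n k) :=
  Finite.of_injective _ (toPart_bij hk).1

theorem card_PA (n : ℕ) : (PA n).ncard = numPartitionPairs n := by
  rw [← Nat.card_coe_set_eq]
  let φ : PA n → Σ k : Fin (n + 1), AS n k × AS n (n - k) := fun p =>
    ⟨⟨∑ i, p.1.1 i, by
        have := p.2.2.2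
        rw [Finset.sum_add_distrib] at this
        omega⟩,
      ⟨p.1.1, p.2.1, rfl⟩, ⟨p.1.2, p.2.2.1, by
        have := p.2.2.2
        rw [Finset.sum_add_distrib] at this
        dsimp only
        omega⟩⟩
  have hφ : Function.Bijective φ := by
    constructor
    · rintro ⟨⟨a, b⟩, hp⟩ ⟨⟨a', b'⟩, hp'⟩ h
      have h1 : ∀ z z' : Σ k : Fin (n + 1), AS n k × AS n (n - k), z = z' →
          z.2.1.1 = z'.2.1.1 ∧ z.2.2.1 = z'.2.2.1 := by
        rintro z _ rfl; exact ⟨rfl, rfl⟩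
      obtain ⟨e1, e2⟩ := h1 _ _ h
      exact Subtype.ext (Prod.ext e1 e2)
    · rintro ⟨⟨k, hk⟩, ⟨a, ha1, ha2⟩, ⟨b, hb1, hb2⟩⟩
      dsimp only at ha2 hb2
      subst ha2
      refine ⟨⟨(a, b), ha1, hb1, ?_⟩, rfl⟩
      rw [Finset.sum_add_distrib]
      dsimp only
      omega
  haveI : ∀ k : Fin (n + 1), Finite (AS n k × AS n (n - k)) := fun k => by
    haveI := AS_finite (n := n) (k := k) (by omega)
    haveI := AS_finite (n := n) (k := n - k) (by omega)
    infer_instance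
  rw [Nat.card_congr (Equiv.ofBijective φ hφ), Nat.card_sigma, numPartitionPairs, Finset.sum_range]
  refine Finset.sum_congr rfl fun k _ => ?_
  rw [Nat.card_prod, card_AS (by omega), card_AS (by omega)]

theorem PD_sum {p : (Fin n → ℕ) × (Fin n → ℕ)} (hp : p ∈ PD n) : 2 * ∑ i, p.1 i = n := by
  have h := hp.1.2.2
  have h2 : ∑ i, (p.1 i + p.2 i) = 2 * ∑ i, p.1 i := by
    rw [Finset.mul_sum]
    refine Finset.sum_congr rfl fun i _ => ?_
    rw [← hp.2]; ring
  rw [← h2]; exact h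

theorem card_PD_odd (hn : Odd n) : (PD n).ncard = 0 := by
  have : PD n = ∅ := by
    ext p
    simp only [Set.mem_empty_iff_false, iff_false]
    intro hp
    have := PD_sum hp
    exact (Nat.not_even_iff_odd.2 hn) ⟨∑ i, p.1 i, by omega⟩
  rw [this, Set.ncard_empty]

theorem card_PD_even (hn : Even n) : (PD n).ncard = numPartitions (n / 2) := by
  rw [← card_AS (n := n) (Nat.div_le_self n 2), ← Nat.card_coe_set_eq]
  obtain ⟨h, hh⟩ := hn
  refine Nat.card_congr (Equiv.ofBijective
    (fun p : PD n => (⟨p.1.1, p.2.1.1, by have := PD_sum p.2; omega⟩ : AS n (n / 2))) ⟨?_, ?_⟩)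
  · intro p q hpq
    have h1 : p.1.1 = q.1.1 := congrArg Subtype.val hpq
    refine Subtype.ext (Prod.ext h1 ?_)
    rw [← p.2.2, ← q.2.2, h1]
  · rintro ⟨a, h1, h2⟩
    refine ⟨⟨(a, a), ⟨h1, h1, ?_⟩, rfl⟩, rfl⟩
    rw [Finset.sum_add_distrib]
    dsimp only
    omega

end Count
end NilOrb

/-- Over a finite field `F` of characteristic 2, the number of nilpotent
`O^+_{2n}(F)`-orbits in `𝔬^+_{2n}(F)` is `(1/2)p₂(n)` if `n` is odd, and
`(1/2)(p₂(n) + p(n/2))` if `n` is even.  Here `V^+` is the non-degenerate quadratic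
space of dimension `2n` whose form has Witt index `n`. -/
theorem nilpotent_orbits_even_orthogonal_plus
    (F : Type*) [Field F] [Fintype F] [CharP F 2]
    (n : ℕ) (hn : 1 ≤ n)
    (V : Type*) [AddCommGroup V] [Module F V] [FiniteDimensional F V]
    (Q : QuadraticForm F V)
    (hdim : Module.finrank F V = 2 * n)
    (hQ : Q.IsNondegenerateFormSpace)
    (hWitt : Q.HasTotallySingularSubspace n) :
    (Odd n → 2 * Q.numNilpotentOOrbits = numPartitionPairs n) ∧
    (Even n → 2 * Q.numNilpotentOOrbits = numPartitionPairs n + numPartitions (n / 2)) := by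
  have h1 := NilOrb.card_orbits hdim hQ hWitt
  have h2 := NilOrb.two_PL n
  rw [h1, NilOrb.card_NFT, h2, NilOrb.card_PA]
  constructor
  · intro ho
    rw [NilOrb.card_PD_odd ho, add_zero]
  · intro he
    rw [NilOrb.card_PD_even he]
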